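/- Let D ⊂ ℂ be a domain and let F be a family of holomorphic functions on D. Let k ≥ 2 be an integer and h a holomorphic function on D, not identically zero, such that h has no common zeros with any f ∈ F. Assume that for every f ∈ F: (a) f(z) = 0 implies f'(z) = h(z), and (b) f'(z) = h(z) implies |f^{(k)}(z)| ≤ c, where c is a fixed constant. Then F is a normal family on D. -/

import Mathlib

/-- A family `F` of holomorphic functions on `D` is normal if every sequence in `F`
has a subsequence which either converges locally uniformly on `D` (to a finite limit
function), or diverges to `∞` locally uniformly on `D`.  This is normality with respect
to the spherical metric. -/
def SphericallyNormalOn (F : Set (ℂ → ℂ)) (D : Set ℂ) : Prop :=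
  ∀ f : ℕ → ℂ → ℂ, (∀ n, f n ∈ F) → ∃ φ : ℕ → ℕ, StrictMono φ ∧
    ((∃ g : ℂ → ℂ, TendstoLocallyUniformlyOn (fun n => f (φ n)) g Filter.atTop D) ∨
      (∀ K : Set ℂ, K ⊆ D → IsCompact K → ∀ M : ℝ,
        ∀ᶠ n in Filter.atTop, ∀ z ∈ K, M ≤ ‖f (φ n) z‖))

section AuxSection
open Complex Metric Set Filter Topology

lemma aux_lip {f : ℂ → ℂ} {x : ℂ} {r C : ℝ} (hr : 0 < r)
    (hf : DifferentiableOn ℂ f (ball x r)) (hC : ∀ z ∈ ball x r, ‖f z‖ ≤ C)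
    {z w : ℂ} (hz : z ∈ ball x (r / 2)) (hw : w ∈ ball x (r / 2)) :
    ‖f z - f w‖ ≤ C / (r / 4) * ‖z - w‖ := by
  have hsub : ∀ y ∈ ball x (r / 2), closedBall y (r / 4) ⊆ ball x r := fun y hy =>
    closedBall_subset_ball' (by rw [mem_ball] at hy; linarith)
  refine (convex_ball x (r / 2)).norm_image_sub_le_of_norm_deriv_le (f := f) ?_ ?_ hw hz
  · intro y hy
    exact hf.differentiableAt (isOpen_ball.mem_nhds (ball_subset_ball (by linarith) hy))
  · intro y hy
    refine norm_deriv_le_of_forall_mem_sphere_norm_le (by linarith) ?_ ?_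
    · refine (hf.mono ?_).diffContOnCl
      exact closure_ball_subset_closedBall.trans (hsub y hy)
    · intro v hv
      exact hC v (hsub y hy (sphere_subset_closedBall hv))

lemma aux_montel {U : Set ℂ} (hU : IsOpen U) (f : ℕ → ℂ → ℂ)
    (H : ∀ x ∈ U, ∃ r > 0, ∃ C : ℝ, ∀ᶠ n in atTop, DifferentiableOn ℂ (f n) (ball x r) ∧
      ∀ z ∈ ball x r, ‖f n z‖ ≤ C) :
    ∃ φ : ℕ → ℕ, StrictMono φ ∧ ∃ g : ℂ → ℂ,
      TendstoLocallyUniformlyOn (fun n => f (φ n)) g atTop U := by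
  classical
  set q := TopologicalSpace.denseSeq ℂ with hq
  have hqd : DenseRange q := TopologicalSpace.denseRange_denseSeq ℂ
  set v : ℕ → ℕ → ℂ := fun n j => if q j ∈ U then f n (q j) else 0 with hv
  have hb : ∀ j, ∃ B : ℝ, ∀ n, ‖v n j‖ ≤ B := by
    intro j
    by_cases hj : q j ∈ U
    · obtain ⟨r, hr, C, hC⟩ := H _ hj
      have : IsBoundedUnder (· ≤ ·) atTop (fun n => ‖v n j‖) := by
        refine ⟨C, ?_⟩
        rw [eventually_map]
        filter_upwards [hC] with n hn
        simp only [hv, if_pos hj]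
        exact hn.2 _ (mem_ball_self hr)
      obtain ⟨B, hB⟩ := this.bddAbove_range
      exact ⟨B, fun n => hB ⟨n, rfl⟩⟩
    · exact ⟨0, fun n => by simp [hv, hj]⟩
  choose B hB using hb
  have hcomp : IsCompact (Set.pi univ fun j : ℕ => closedBall (0:ℂ) (B j)) :=
    isCompact_univ_pi fun j => isCompact_closedBall _ _
  obtain ⟨a, -, φ, hφ, hlim⟩ := hcomp.tendsto_subseq (x := v)
    (fun n j _ => by rw [mem_closedBall_zero_iff]; exact hB j n)
  have hlim' : ∀ j, Tendsto (fun n => v (φ n) j) atTop (𝓝 (a j)) := fun j =>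
    (tendsto_pi_nhds.1 hlim) j
  have hcauchy : ∀ x ∈ U, ∃ s > 0, UniformCauchySeqOn (fun n => f (φ n)) atTop (ball x s) := by
    intro x hx
    obtain ⟨r, hr, C, hC⟩ := H x hx
    obtain ⟨r1, hr1, hr1U⟩ := Metric.isOpen_iff.1 hU x hx
    set r0 := min r r1 with hr0
    have hr0p : 0 < r0 := lt_min hr hr1
    refine ⟨r0 / 4, by positivity, ?_⟩
    rw [Metric.uniformCauchySeqOn_iff]
    intro ε hε
    have hCn := hφ.tendsto_atTop.eventually hC
    have hC0 : 0 ≤ C := by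
      obtain ⟨n, hn⟩ := hC.exists
      exact (norm_nonneg _).trans (hn.2 x (mem_ball_self hr))
    set L := C / (r0 / 4) with hL
    have hL0 : 0 ≤ L := by positivity
    set δ := min (ε / (3 * (L + 1))) (r0 / 4) with hδ
    have hδp : 0 < δ := lt_min (by positivity) (by positivity)
    obtain ⟨J, hJ⟩ := (isCompact_closedBall x (r0 / 4)).elim_finite_subcover
      (fun j : ℕ => ball (q j) δ) (fun j => isOpen_ball) (by
        intro z _
        obtain ⟨j, hj⟩ := hqd.exists_dist_lt z hδp
        exact mem_iUnion.2 ⟨j, hj⟩)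
    have hcs : ∀ j ∈ J, ∀ᶠ n in atTop, ‖v (φ n) j - a j‖ < ε / 6 := by
      intro j _
      have := (Metric.tendsto_nhds.1 (hlim' j)) (ε / 6) (by positivity)
      simpa [dist_eq_norm] using this
    obtain ⟨N, hN⟩ := eventually_atTop.1 (((Finset.eventually_all J).2 hcs).and hCn)
    refine ⟨N, fun m hm n hn z hz => ?_⟩
    obtain ⟨j, hjJ, hj⟩ := mem_iUnion₂.1 (hJ (ball_subset_closedBall hz))
    have hqj : q j ∈ ball x (r0 / 2) := by
      rw [mem_ball] at hz hj ⊢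
      rw [dist_comm] at hj
      have := dist_triangle (q j) z x
      have := min_le_right (ε / (3 * (L + 1))) (r0 / 4)
      linarith
    have hz2 : z ∈ ball x (r0 / 2) := ball_subset_ball (by linarith) hz
    have hqU : q j ∈ U := hr1U (ball_subset_ball (by
      have := min_le_right r r1; linarith) hqj)
    have est : ∀ n ≥ N, ‖f (φ n) z - f (φ n) (q j)‖ ≤ ε / 3 := by
      intro n hn
      have hh := (hN n hn).2
      have hsub : ball x r0 ⊆ ball x r := ball_subset_ball (min_le_left _ _)
      have h1 := aux_lip hr0p (hh.1.mono hsub) (fun z hz => hh.2 z (hsub hz)) hz2 hqj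
      refine h1.trans ?_
      rw [mem_ball, dist_eq_norm] at hj
      have h2 : ‖z - q j‖ ≤ ε / (3 * (L + 1)) := hj.le.trans (min_le_left _ _)
      calc L * ‖z - q j‖ ≤ (L + 1) * (ε / (3 * (L + 1))) := by gcongr; linarith
        _ = ε / 3 := by field_simp
    have e1 := est m hm
    have e2 := est n hn
    have e3 := (hN m hm).1 j hjJ
    have e4 := (hN n hn).1 j hjJ
    simp only [hv, if_pos hqU] at e3 e4
    rw [dist_eq_norm]
    have : f (φ m) z - f (φ n) z = (f (φ m) z - f (φ m) (q j)) - (f (φ n) z - f (φ n) (q j))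
        + ((f (φ m) (q j) - a j) - (f (φ n) (q j) - a j)) := by ring
    rw [this]
    have t1 := norm_add_le ((f (φ m) z - f (φ m) (q j)) - (f (φ n) z - f (φ n) (q j)))
      ((f (φ m) (q j) - a j) - (f (φ n) (q j) - a j))
    have t2 := norm_sub_le (f (φ m) z - f (φ m) (q j)) (f (φ n) z - f (φ n) (q j))
    have t3 := norm_sub_le (f (φ m) (q j) - a j) (f (φ n) (q j) - a j)
    linarith
  have hpt : ∀ x ∈ U, ∃ l, Tendsto (fun n => f (φ n) x) atTop (𝓝 l) := by
    intro x hx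
    obtain ⟨s, hs, hc⟩ := hcauchy x hx
    exact cauchySeq_tendsto_of_complete (hc.cauchySeq (mem_ball_self hs))
  choose! g hg using hpt
  refine ⟨φ, hφ, g, ?_⟩
  rw [tendstoLocallyUniformlyOn_iff_forall_tendsto]
  intro x hx
  obtain ⟨s, hs, hc⟩ := hcauchy x hx
  obtain ⟨r1, hr1, hr1U⟩ := Metric.isOpen_iff.1 hU x hx
  have hu : TendstoUniformlyOn (fun n => f (φ n)) g atTop (ball x (min s r1)) :=
    (hc.mono (ball_subset_ball (min_le_left _ _))).tendstoUniformlyOn_of_tendsto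
      (fun z hz => hg z (hr1U (ball_subset_ball (min_le_right _ _) hz)))
  rw [tendstoUniformlyOn_iff_tendsto] at hu
  refine hu.mono_left (Filter.prod_mono le_rfl ?_)
  refine nhdsWithin_le_nhds.trans ?_
  rw [le_principal_iff]
  exact ball_mem_nhds _ (lt_min hs hr1)

/-- Diagonal subsequence lemma. -/
lemma aux_diag (P : ℕ → (ℕ → ℕ) → Prop)
    (hsub : ∀ j φ, StrictMono φ → ∃ ψ : ℕ → ℕ, StrictMono ψ ∧ P j (φ ∘ ψ))
    (hinh : ∀ j φ ψ, P j φ → (∃ χ : ℕ → ℕ, Tendsto χ atTop atTop ∧ ∀ᶠ n in atTop, ψ n = φ (χ n)) →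
      P j ψ) :
    ∃ φ : ℕ → ℕ, StrictMono φ ∧ ∀ j, P j φ := by
  choose! s hs hsP using hsub
  -- iterated subsequences
  let Φ : ℕ → ℕ → ℕ := fun j => Nat.rec (motive := fun _ => ℕ → ℕ) id (fun j φ => φ ∘ s j φ) j
  have hΦ0 : Φ 0 = id := rfl
  have hΦs : ∀ j, Φ (j + 1) = Φ j ∘ s j (Φ j) := fun j => rfl
  have hmono : ∀ j, StrictMono (Φ j) := by
    intro j
    induction j with
    | zero => exact strictMono_id
    | succ j ih => rw [hΦs]; exact ih.comp (hs j _ ih)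
  have hfac : ∀ j m, ∃ χ : ℕ → ℕ, StrictMono χ ∧ Φ (j + m) = Φ j ∘ χ := by
    intro j m
    induction m with
    | zero => exact ⟨id, strictMono_id, rfl⟩
    | succ m ih =>
      obtain ⟨χ, h1, h2⟩ := ih
      refine ⟨χ ∘ s (j + m) (Φ (j + m)), h1.comp (hs _ _ (hmono _)), ?_⟩
      rw [← add_assoc, hΦs]
      nth_rewrite 1 [h2]
      rfl
  refine ⟨fun n => Φ n n, ?_, ?_⟩
  · refine strictMono_nat_of_lt_succ fun n => ?_
    rw [hΦs]
    refine hmono n ?_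
    exact lt_of_lt_of_le (Nat.lt_succ_self n) ((hs n _ (hmono n)).id_le (n + 1))
  · intro j
    refine hinh j (Φ (j + 1)) _ (by rw [hΦs]; exact hsP j _ (hmono j)) ?_
    choose χ hχ1 hχ2 using hfac (j + 1)
    refine ⟨fun n => χ (n - (j + 1)) n, ?_, ?_⟩
    · exact tendsto_atTop_mono (fun n => (hχ1 _).id_le n) tendsto_id
    · filter_upwards [eventually_ge_atTop (j + 1)] with n hn
      have := congrFun (hχ2 (n - (j + 1))) n
      rw [Nat.add_sub_cancel' hn] at this
      exact this

def AuxConv (f : ℕ → ℂ → ℂ) (x : ℂ) (r : ℝ) : Prop :=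
  ∃ g : ℂ → ℂ, TendstoUniformlyOn f g atTop (ball x r)

def AuxDiv (f : ℕ → ℂ → ℂ) (x : ℂ) (r : ℝ) : Prop :=
  ∀ M : ℝ, ∀ᶠ n in atTop, ∀ w ∈ ball x r, M ≤ ‖f n w‖

/-- Uniform local normality at a point. -/
def AuxNormalAt (F : Set (ℂ → ℂ)) (x : ℂ) : Prop :=
  ∃ r > 0, ∀ f : ℕ → ℂ → ℂ, (∀ n, f n ∈ F) → ∃ φ : ℕ → ℕ, StrictMono φ ∧
    (AuxConv (fun n => f (φ n)) x r ∨ AuxDiv (fun n => f (φ n)) x r)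

lemma aux_assemble {F : Set (ℂ → ℂ)} {S : Set ℂ} (hS : IsPreconnected S)
    (H : ∀ x ∈ S, AuxNormalAt F x) (f : ℕ → ℂ → ℂ) (hf : ∀ n, f n ∈ F) :
    ∃ φ : ℕ → ℕ, StrictMono φ ∧
      ((∀ x ∈ S, ∃ r > 0, AuxConv (fun n => f (φ n)) x r) ∨
       (∀ x ∈ S, ∃ r > 0, AuxDiv (fun n => f (φ n)) x r)) := by
  classical
  rcases S.eq_empty_or_nonempty with rfl | hne
  · exact ⟨id, strictMono_id, Or.inl (by simp)⟩
  choose! r hr hsq using H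
  obtain ⟨T, hTS, hTc, hTcov⟩ := TopologicalSpace.countable_cover_nhdsWithin (s := S)
    (f := fun x => ball x (r x)) (fun x hx => mem_nhdsWithin_of_mem_nhds (ball_mem_nhds x (hr x hx)))
  have hTne : T.Nonempty := by
    obtain ⟨x, hx⟩ := hne
    obtain ⟨t, ht, -⟩ := mem_iUnion₂.1 (hTcov hx)
    exact ⟨t, ht⟩
  obtain ⟨e, he⟩ := hTc.exists_eq_range hTne
  have heS : ∀ j, e j ∈ S := fun j => hTS (he ▸ mem_range_self j)
  obtain ⟨φ, hφ, hP⟩ := aux_diag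
    (fun j φ => AuxConv (fun n => f (φ n)) (e j) (r (e j)) ∨
      AuxDiv (fun n => f (φ n)) (e j) (r (e j))) (by
      intro j φ hφ
      exact hsq (e j) (heS j) (fun n => f (φ n)) (fun n => hf _)) (by
      rintro j φ ψ h ⟨χ, hχ, heq⟩
      rcases h with ⟨g, hg⟩ | h
      · left
        refine ⟨g, fun u hu => ?_⟩
        filter_upwards [heq, hχ.eventually (hg u hu)] with n h1 h2
        rw [h1]; exact h2
      · right
        intro M
        filter_upwards [heq, hχ.eventually (h M)] with n h1 h2
        rw [h1]; exact h2)
  refine ⟨φ, hφ, ?_⟩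
  set A := ⋃ j ∈ {j | AuxConv (fun n => f (φ n)) (e j) (r (e j))}, ball (e j) (r (e j)) with hA
  set B := ⋃ j ∈ {j | AuxDiv (fun n => f (φ n)) (e j) (r (e j))}, ball (e j) (r (e j)) with hB
  have hAo : IsOpen A := isOpen_biUnion fun _ _ => isOpen_ball
  have hBo : IsOpen B := isOpen_biUnion fun _ _ => isOpen_ball
  have hAp : ∀ x ∈ A, ∃ r > 0, AuxConv (fun n => f (φ n)) x r := by
    intro x hx
    obtain ⟨j, ⟨g, hg⟩, hj⟩ := mem_iUnion₂.1 hx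
    obtain ⟨s, hs, hsb⟩ := Metric.isOpen_iff.1 isOpen_ball x hj
    exact ⟨s, hs, g, hg.mono hsb⟩
  have hBp : ∀ x ∈ B, ∃ r > 0, AuxDiv (fun n => f (φ n)) x r := by
    intro x hx
    obtain ⟨j, h, hj⟩ := mem_iUnion₂.1 hx
    obtain ⟨s, hs, hsb⟩ := Metric.isOpen_iff.1 isOpen_ball x hj
    refine ⟨s, hs, fun M => ?_⟩
    filter_upwards [h M] with n hn w hw using hn w (hsb hw)
  have hcov : S ⊆ A ∪ B := by
    intro x hx
    obtain ⟨t, ht, hxt⟩ := mem_iUnion₂.1 (hTcov hx)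
    rw [he] at ht
    obtain ⟨j, rfl⟩ := ht
    rcases hP j with h | h
    · exact Or.inl (mem_iUnion₂.2 ⟨j, h, hxt⟩)
    · exact Or.inr (mem_iUnion₂.2 ⟨j, h, hxt⟩)
  have hdisj : S ∩ (A ∩ B) = ∅ := by
    rw [eq_empty_iff_forall_notMem]
    rintro x ⟨-, hxA, hxB⟩
    obtain ⟨s, hs, g, hg⟩ := hAp x hxA
    obtain ⟨t, ht, hd⟩ := hBp x hxB
    have h1 := (hg.tendsto_at (mem_ball_self hs)).norm
    have h2 := h1.eventually (gt_mem_nhds (lt_add_one ‖g x‖))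
    obtain ⟨n, h3, h4⟩ := (h2.and (hd (‖g x‖ + 1))).exists
    have := h4 x (mem_ball_self ht)
    linarith
  rcases (isPreconnected_iff_subset_of_disjoint.1 hS) A B hAo hBo hcov hdisj with h | h
  · exact Or.inl fun x hx => hAp x (h hx)
  · exact Or.inr fun x hx => hBp x (h hx)

lemma aux_div_compact {f : ℕ → ℂ → ℂ} {K : Set ℂ} (hK : IsCompact K)
    (h : ∀ x ∈ K, ∃ r > 0, AuxDiv f x r) (M : ℝ) : ∀ᶠ n in atTop, ∀ z ∈ K, M ≤ ‖f n z‖ := by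
  choose! r hr hd using h
  obtain ⟨t, htK, hcov⟩ := hK.elim_nhds_subcover (fun x => ball x (r x))
    (fun x hx => ball_mem_nhds x (hr x hx))
  have := (Finset.eventually_all t).2 (fun x hx => hd x (htK x hx) M)
  filter_upwards [this] with n hn z hz
  obtain ⟨x, hx, hzx⟩ := mem_iUnion₂.1 (hcov hz)
  exact hn x hx z hzx

lemma aux_conv_local {f : ℕ → ℂ → ℂ} {D : Set ℂ}
    (h : ∀ x ∈ D, ∃ r > 0, AuxConv f x r) : ∃ g, TendstoLocallyUniformlyOn f g atTop D := by
  have hpt : ∀ x ∈ D, ∃ l, Tendsto (fun n => f n x) atTop (𝓝 l) := by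
    intro x hx
    obtain ⟨r, hr, g, hg⟩ := h x hx
    exact ⟨g x, hg.tendsto_at (mem_ball_self hr)⟩
  choose! g hg using hpt
  refine ⟨g, ?_⟩
  intro u hu x hx
  obtain ⟨r, hr, g', hg'⟩ := h x hx
  refine ⟨ball x r ∩ D, inter_mem (mem_nhdsWithin_of_mem_nhds (ball_mem_nhds x hr))
    self_mem_nhdsWithin, ?_⟩
  filter_upwards [hg' u hu] with n hn y hy
  have : g y = g' y := tendsto_nhds_unique (hg y hy.2) (hg'.tendsto_at hy.1)
  rw [this]
  exact hn y hy.1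

lemma aux_exists_log {f : ℂ → ℂ} {w : ℂ} {R : ℝ} (hR : 0 < R)
    (hf : DifferentiableOn ℂ f (ball w R)) (h0 : ∀ z ∈ ball w R, f z ≠ 0) :
    ∃ q : ℂ → ℂ, (∀ z ∈ ball w R, HasDerivAt q (deriv f z / f z) z) ∧
      ∀ z ∈ ball w R, f z = exp (q z) := by
  have hw : w ∈ ball w R := mem_ball_self hR
  have hd : DifferentiableOn ℂ (fun z => deriv f z / f z) (ball w R) :=
    (hf.deriv isOpen_ball).div hf h0
  obtain ⟨q, hqw, hq⟩ := hd.isExactOn_ball.with_val_at w (log (f w))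
  refine ⟨q, hq, fun z hz => ?_⟩
  have hD : ∀ x ∈ ball w R, HasDerivAt (fun z => f z * exp (-q z)) 0 x := by
    intro x hx
    have h1 : HasDerivAt f (deriv f x) x :=
      (hf.differentiableAt (isOpen_ball.mem_nhds hx)).hasDerivAt
    have hx0 := h0 x hx
    have e : f x * (exp (-q x) * -(deriv f x / f x)) = -(deriv f x * exp (-q x)) := by
      field_simp
    exact (h1.mul ((hq x hx).neg.cexp)).congr_deriv (by
      change deriv f x * exp (-q x) + f x * (exp (-q x) * -(deriv f x / f x)) = 0
      rw [e]; ring)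
  have hc := isOpen_ball.is_const_of_deriv_eq_zero (convex_ball w R).isPreconnected
    (f := fun z => f z * exp (-q z)) (fun x hx => (hD x hx).differentiableAt.differentiableWithinAt)
    (fun x hx => (hD x hx).deriv) hz hw
  simp only [hqw, exp_neg, exp_log (h0 w hw), mul_inv_cancel₀ (h0 w hw)] at hc
  have := exp_ne_zero (q z)
  field_simp at hc
  exact hc

lemma aux_halfplane {a b : ℂ} (ha : 0 < a.re) (hb : 0 < b.re) :
    ‖a - b‖ ≤ ‖a + (starRingEnd ℂ) b‖ := by
  rw [← sq_le_sq₀ (norm_nonneg _) (norm_nonneg _), Complex.sq_norm, Complex.sq_norm]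
  simp [normSq_apply]
  nlinarith [mul_pos ha hb]

lemma aux_harnack {a b : ℂ} {t : ℝ} (ht0 : 0 ≤ t) (ht1 : t < 1) (ha : 0 < a.re) (hb : 0 < b.re)
    (h : ‖a - b‖ ≤ t * ‖a + (starRingEnd ℂ) b‖) : b.re * (1 - t) ≤ a.re * (1 + t) := by
  have h2 : ‖a - b‖ ^ 2 ≤ (t * ‖a + (starRingEnd ℂ) b‖) ^ 2 :=
    pow_le_pow_left₀ (norm_nonneg _) h 2
  rw [mul_pow, Complex.sq_norm, Complex.sq_norm] at h2
  simp [normSq_apply] at h2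
  have h3 : (a.re - b.re) ^ 2 ≤ (t * (a.re + b.re)) ^ 2 := by
    have : 0 ≤ (1 - t ^ 2) * (a.im - b.im) ^ 2 := by
      apply mul_nonneg _ (sq_nonneg _); nlinarith
    nlinarith
  have h4 := abs_le_of_sq_le_sq h3 (by positivity)
  have := abs_le.1 h4
  nlinarith [this.1]

lemma aux_hopf {f : ℂ → ℂ} {w ζ : ℂ} {R : ℝ} (hR : 0 < R)
    (hf : DifferentiableOn ℂ f (ball w R)) (h1 : ∀ z ∈ ball w R, 1 < ‖f z‖)
    (hζ : ‖ζ - w‖ = R) (hdζ : DifferentiableAt ℂ f ζ) (hfζ : ‖f ζ‖ = 1) :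
    Real.log ‖f w‖ ≤ 2 * R * ‖deriv f ζ‖ ∧ ‖deriv f w‖ ≤ 4 * ‖deriv f ζ‖ * ‖f w‖ := by
  have hw : w ∈ ball w R := mem_ball_self hR
  have h0 : ∀ z ∈ ball w R, f z ≠ 0 := fun z hz h => by
    have := h1 z hz; rw [h] at this; simp at this; linarith
  obtain ⟨q, hq, hfq⟩ := aux_exists_log hR hf h0
  have hre : ∀ z ∈ ball w R, (q z).re = Real.log ‖f z‖ := fun z hz => by
    rw [hfq z hz, norm_exp, Real.log_exp]
  have hpos : ∀ z ∈ ball w R, 0 < (q z).re := fun z hz => by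
    rw [hre z hz]; exact Real.log_pos (h1 z hz)
  have hden : ∀ z ∈ ball w R, q z + (starRingEnd ℂ) (q w) ≠ 0 := fun z hz h => by
    have := congrArg re h
    simp at this
    linarith [hpos z hz, hpos w hw]
  set Φ : ℂ → ℂ := fun z => (q z - q w) / (q z + (starRingEnd ℂ) (q w)) with hΦ
  have hΦd : ∀ z ∈ ball w R, HasDerivAt Φ ((deriv f z / f z * (q z + (starRingEnd ℂ) (q w)) -
      (q z - q w) * (deriv f z / f z)) / (q z + (starRingEnd ℂ) (q w)) ^ 2) z := fun z hz =>
    ((hq z hz).sub_const _).div ((hq z hz).add_const _) (hden z hz)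
  have hΦD : DifferentiableOn ℂ Φ (ball w R) := fun z hz =>
    (hΦd z hz).differentiableAt.differentiableWithinAt
  have hΦw : Φ w = 0 := by simp [hΦ]
  have hmap : MapsTo Φ (ball w R) (closedBall (Φ w) 1) := by
    intro z hz
    rw [hΦw, mem_closedBall_zero_iff, hΦ]
    simp only [norm_div]
    exact div_le_one_of_le₀ (aux_halfplane (hpos z hz) (hpos w hw)) (norm_nonneg _)
  have hu := hpos w hw
  have hA : Real.log ‖f w‖ ≤ 2 * R * ‖deriv f ζ‖ := by
    rw [← hre w hw]
    -- radial points
    have key : ∀ t ∈ Ioo (0:ℝ) 1, (q w).re * (1 - t) ≤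
        ‖f (w + t * (ζ - w)) - f ζ‖ * (1 + t) := by
      intro t ht
      set z := w + t * (ζ - w) with hz
      have hzw : dist z w = t * R := by
        rw [dist_eq_norm, hz, add_sub_cancel_left, norm_mul, hζ]
        simp [abs_of_pos ht.1]
      have hzb : z ∈ ball w R := by
        rw [mem_ball, hzw]; nlinarith [ht.2]
      have hS := dist_le_div_mul_dist_of_mapsTo_ball hΦD hmap hzb
      rw [hΦw, dist_zero_right, hzw] at hS
      have hS' : ‖Φ z‖ ≤ t := by
        convert hS using 1; field_simp
      have hb : ‖q z - q w‖ ≤ t * ‖q z + (starRingEnd ℂ) (q w)‖ := by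
        rw [hΦ] at hS'
        simp only [norm_div] at hS'
        rwa [div_le_iff₀ (norm_pos_iff.2 (hden z hzb))] at hS'
      have hH := aux_harnack ht.1.le ht.2 (hpos z hzb) hu hb
      have h2 : (q z).re ≤ ‖f z - f ζ‖ := by
        have e1 : (q z).re + 1 ≤ ‖f z‖ := by
          rw [hfq z hzb, norm_exp]; exact Real.add_one_le_exp _
        have e2 : ‖f z‖ ≤ ‖f z - f ζ‖ + ‖f ζ‖ := by
          simpa using norm_add_le (f z - f ζ) (f ζ)
        linarith
      have := ht.1
      nlinarith
    have hline : HasDerivAt (fun t : ℝ => f (w + t * (ζ - w))) (deriv f ζ * (ζ - w)) 1 := by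
      have e1 : HasDerivAt (fun t : ℝ => w + (t:ℂ) * (ζ - w)) (ζ - w) 1 := by
        have := (((hasDerivAt_id (1:ℂ)).mul_const (ζ - w)).const_add w).comp_ofReal
        simpa using this
      have e2 : HasDerivAt f (deriv f ζ) (w + ((1:ℝ):ℂ) * (ζ - w)) := by
        have : w + ((1:ℝ):ℂ) * (ζ - w) = ζ := by simp
        rw [this]; exact hdζ.hasDerivAt
      exact e2.scomp_of_eq (1:ℝ) e1 rfl |>.congr_deriv (by simp [mul_comm])
    have hsl := (hline.tendsto_slope).mono_left
      (nhdsWithin_mono (1:ℝ) (s := Iio 1) (fun x hx => ne_of_lt hx))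
    have hsl2 := (hsl.norm).mul (((continuous_const.add continuous_id).tendsto
      (1:ℝ)).mono_left nhdsWithin_le_nhds : Tendsto (fun t : ℝ => 1 + t) (𝓝[<] 1) (𝓝 (1 + 1)))
    have hle : (q w).re ≤ ‖deriv f ζ * (ζ - w)‖ * (1 + 1) := by
      refine ge_of_tendsto hsl2 ?_
      filter_upwards [Ioo_mem_nhdsLT (zero_lt_one' ℝ)] with t ht
      have k := key t ht
      rw [slope_def_module, norm_smul]
      have e3 : ‖(t - 1)⁻¹‖ = (1 - t)⁻¹ := by
        rw [norm_inv, Real.norm_eq_abs, abs_of_neg (by linarith [ht.2])]; ring_nf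
      have e4 : w + ((1:ℝ):ℂ) * (ζ - w) = ζ := by simp
      rw [e3, e4]
      have : 0 < 1 - t := by linarith [ht.2]
      rw [inv_mul_eq_div, div_mul_eq_mul_div, le_div_iff₀ this]
      exact k
    rw [norm_mul, hζ] at hle
    linarith
  refine ⟨hA, ?_⟩
  have hD := norm_deriv_le_div_of_mapsTo_ball hΦD hmap hR
  rw [(hΦd w hw).deriv] at hD
  have e5 : q w + (starRingEnd ℂ) (q w) = ((2 * (q w).re : ℝ) : ℂ) := by
    rw [add_conj]
  have hfw := norm_pos_iff.2 (h0 w hw)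
  rw [sub_self, zero_mul, sub_zero, norm_div, norm_mul, norm_pow, e5, norm_real, norm_div,
    Real.norm_of_nonneg (by linarith)] at hD
  rw [div_le_div_iff₀ (by positivity) hR, one_mul, sq, ← mul_assoc] at hD
  have hD2 : ‖deriv f w‖ / ‖f w‖ * R ≤ 2 * (q w).re := by
    have : 0 < 2 * (q w).re := by linarith
    nlinarith
  have hD3 : ‖deriv f w‖ / ‖f w‖ * R ≤ 4 * ‖deriv f ζ‖ * R := by
    rw [hre w hw] at hD2
    linarith
  have hD4 := le_of_mul_le_mul_right hD3 hR
  rwa [div_le_iff₀ hfw] at hD4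

/-- First hitting radius. -/
lemma aux_touch {u : ℂ → ℝ} {w p : ℂ} {b : ℝ} (hu : ContinuousOn u (closedBall w ‖p - w‖))
    (hw : b < u w) (hp : u p ≤ b) :
    ∃ R > 0, ∃ ζ, R ≤ ‖p - w‖ ∧ ‖ζ - w‖ = R ∧ u ζ = b ∧ ∀ z ∈ ball w R, b < u z := by
  set K := closedBall w ‖p - w‖ ∩ u ⁻¹' (Iic b) with hK
  have hKc : IsCompact K := by
    have : IsClosed K := hu.preimage_isClosed_of_isClosed isClosed_closedBall isClosed_Iic
    exact (isCompact_closedBall w ‖p - w‖).of_isClosed_subset this inter_subset_left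
  have hpK : p ∈ K := ⟨by simp [dist_eq_norm], hp⟩
  obtain ⟨ζ, hζK, hζ⟩ := hKc.exists_isMinOn ⟨p, hpK⟩
    (f := fun z => ‖z - w‖) (by fun_prop)
  have hne : ζ ≠ w := by
    rintro rfl; exact absurd hζK.2 (not_le.2 hw)
  have hR : 0 < ‖ζ - w‖ := norm_pos_iff.2 (sub_ne_zero.2 hne)
  have hle : ‖ζ - w‖ ≤ ‖p - w‖ := hζ hpK
  have hball : ∀ z ∈ ball w ‖ζ - w‖, b < u z := by
    intro z hz
    by_contra hcon
    rw [mem_ball, dist_eq_norm] at hz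
    have : z ∈ K := ⟨by rw [mem_closedBall, dist_eq_norm]; linarith, not_lt.1 hcon⟩
    exact absurd (hζ this) (not_le.2 hz)
  refine ⟨‖ζ - w‖, hR, ζ, hle, rfl, le_antisymm hζK.2 ?_, hball⟩
  have hcl : ζ ∈ closure (ball w ‖ζ - w‖) := by
    rw [closure_ball w hR.ne']; simp [dist_eq_norm]
  have hcont : ContinuousWithinAt u (ball w ‖ζ - w‖) ζ :=
    (hu ζ hζK.1).mono (ball_subset_closedBall.trans (closedBall_subset_closedBall hle))
  have := mem_closure_iff_nhdsWithin_neBot.1 hcl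
  exact ge_of_tendsto hcont (eventually_nhdsWithin_of_forall fun z hz => (hball z hz).le)

/-- Argument of Pommerenke. -/
lemma aux_pommerenke {f : ℂ → ℂ} {w p : ℂ} {C : ℝ} {U : Set ℂ} (hU : IsOpen U)
    (hf : DifferentiableOn ℂ f U) (hUb : closedBall w ‖p - w‖ ⊆ U)
    (hw : 1 < ‖f w‖) (hp : ‖f p‖ ≤ 1)
    (hd : ∀ z ∈ closedBall w ‖p - w‖, ‖f z‖ = 1 → ‖deriv f z‖ ≤ C) :
    Real.log ‖f w‖ ≤ 2 * ‖p - w‖ * C ∧ ‖deriv f w‖ ≤ 4 * C * ‖f w‖ := by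
  obtain ⟨R, hR, ζ, hRp, hζ, hfζ, hball⟩ := aux_touch (u := fun z => ‖f z‖) (b := 1)
    ((hf.continuousOn.mono hUb).norm) hw hp
  have hζb : ζ ∈ closedBall w ‖p - w‖ := by
    rw [mem_closedBall, dist_eq_norm, hζ]; exact hRp
  have hbb : ball w R ⊆ U := (ball_subset_closedBall.trans
    (closedBall_subset_closedBall hRp)).trans hUb
  obtain ⟨h1, h2⟩ := aux_hopf hR (hf.mono hbb) hball hζ
    (hf.differentiableAt (hU.mem_nhds (hUb hζb))) hfζ
  have h3 := hd ζ hζb hfζ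
  refine ⟨h1.trans ?_, h2.trans ?_⟩
  · have := mul_le_mul hRp h3 (norm_nonneg _) (norm_nonneg _)
    linarith
  · gcongr

lemma aux_minmod {f : ℂ → ℂ} {x : ℂ} {s m : ℝ} (hs : 0 < s)
    (hf : ContinuousOn f (closedBall x s)) (hd : DifferentiableOn ℂ f (ball x s))
    (h0 : ∀ z ∈ ball x s, f z ≠ 0) (hm : 0 < m) (hsp : ∀ z ∈ sphere x s, m ≤ ‖f z‖) :
    ∀ z ∈ closedBall x s, m ≤ ‖f z‖ := by
  have h0' : ∀ z ∈ closedBall x s, f z ≠ 0 := by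
    intro z hz
    rcases eq_or_lt_of_le (mem_closedBall.1 hz) with h | h
    · intro hh
      have := hsp z h
      rw [hh, norm_zero] at this; linarith
    · exact h0 z h
  have hdc : DiffContOnCl ℂ (fun z => (f z)⁻¹) (ball x s) := by
    refine ⟨hd.fun_inv h0, ?_⟩
    rw [closure_ball x hs.ne']
    exact hf.inv₀ h0'
  intro z hz
  have := Complex.norm_le_of_forall_mem_frontier_norm_le (isBounded_ball (x := x) (r := s)) hdc
    (C := m⁻¹) (by
      intro w hw
      rw [frontier_ball x hs.ne'] at hw
      rw [norm_inv]
      exact inv_anti₀ hm (hsp w hw)) (z := z) (by rwa [closure_ball x hs.ne'])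
  rw [norm_inv] at this
  exact (inv_le_inv₀ (norm_pos_iff.2 (h0' z hz)) hm).1 this

lemma aux_hurwitz {f : ℕ → ℂ → ℂ} {g : ℂ → ℂ} {z0 : ℂ} {r : ℝ} (hr : 0 < r)
    (hf : ∀ᶠ n in atTop, DifferentiableOn ℂ (f n) (ball z0 r))
    (hc : TendstoLocallyUniformlyOn f g atTop (ball z0 r)) (h0 : g z0 = 0)
    (hne : ¬ ∀ᶠ z in 𝓝 z0, g z = 0) :
    ∀ ε > 0, ∀ᶠ n in atTop, ∃ z ∈ ball z0 ε, f n z = 0 := by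
  intro ε hε
  have hg : DifferentiableOn ℂ g (ball z0 r) := hc.differentiableOn hf isOpen_ball
  have hgan : AnalyticAt ℂ g z0 :=
    hg.analyticAt (isOpen_ball.mem_nhds (mem_ball_self hr))
  have hiso : ∀ᶠ z in 𝓝[≠] z0, g z ≠ 0 := by
    rcases hgan.eventually_eq_zero_or_eventually_ne_zero with h | h
    · exact absurd h hne
    · exact h
  rw [eventually_nhdsWithin_iff, Metric.eventually_nhds_iff_ball] at hiso
  obtain ⟨δ, hδ, hδ0⟩ := hiso
  set s := min (min (δ / 2) (r / 2)) (ε / 2) with hsdef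
  have hs : 0 < s := by positivity
  have hsδ : s < δ := lt_of_le_of_lt ((min_le_left _ _).trans (min_le_left _ _)) (by linarith)
  have hsr : s < r := lt_of_le_of_lt ((min_le_left _ _).trans (min_le_right _ _)) (by linarith)
  have hsε : s < ε := lt_of_le_of_lt (min_le_right _ _) (by linarith)
  have hsub : closedBall z0 s ⊆ ball z0 r := closedBall_subset_ball hsr
  have hsp : (sphere z0 s).Nonempty := (NormedSpace.sphere_nonempty).2 hs.le
  obtain ⟨y, hy, hymin⟩ := (isCompact_sphere z0 s).exists_isMinOn hsp
    (f := fun z => ‖g z‖) ((hg.continuousOn.mono (sphere_subset_closedBall.trans hsub)).norm)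
  have hy0 : 0 < ‖g y‖ := by
    rw [norm_pos_iff]
    apply hδ0 y
    · rw [mem_ball]; rw [mem_sphere] at hy; linarith
    · intro h
      rw [mem_singleton_iff] at h
      rw [h, mem_sphere, dist_self] at hy; linarith
  set m := ‖g y‖ with hm
  have hu := (tendstoLocallyUniformlyOn_iff_forall_isCompact isOpen_ball).1 hc _ hsub
    (isCompact_closedBall z0 s)
  rw [Metric.tendstoUniformlyOn_iff] at hu
  filter_upwards [hf, hu (m / 3) (by positivity)] with n hfn hn
  by_contra hcon
  push Not at hcon
  have hz0 := aux_minmod (f := f n) (x := z0) (m := m * 2 / 3) hs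
    (hfn.continuousOn.mono hsub) (hfn.mono (ball_subset_closedBall.trans hsub))
    (fun z hz => hcon z (ball_subset_ball hsε.le hz)) (by positivity) (fun z hz => by
      have h1 := hn z (sphere_subset_closedBall hz)
      have h2 : m ≤ ‖g z‖ := hymin hz
      rw [dist_eq_norm] at h1
      have h3 := norm_sub_norm_le (g z) (f n z)
      linarith) z0 (mem_closedBall_self hs.le)
  have h1 := hn z0 (mem_closedBall_self hs.le)
  rw [h0, dist_zero_left] at h1
  linarith

lemma aux_montel_ball {f : ℕ → ℂ → ℂ} {x : ℂ} {r s C : ℝ} (hs : s < r)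
    (hd : ∀ᶠ n in atTop, DifferentiableOn ℂ (f n) (ball x r))
    (hb : ∀ᶠ n in atTop, ∀ z ∈ ball x r, ‖f n z‖ ≤ C) :
    ∃ φ : ℕ → ℕ, StrictMono φ ∧ AuxConv (fun n => f (φ n)) x s := by
  obtain ⟨φ, hφ, g, hg⟩ := aux_montel (isOpen_ball (x := x) (ε := r)) f (by
    intro y hy
    obtain ⟨ε, hε, hsub⟩ := Metric.isOpen_iff.1 isOpen_ball y hy
    refine ⟨ε, hε, C, ?_⟩
    filter_upwards [hd, hb] with n h1 h2
    exact ⟨h1.mono hsub, fun z hz => h2 z (hsub hz)⟩)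
  refine ⟨φ, hφ, g, ?_⟩
  exact ((tendstoLocallyUniformlyOn_iff_forall_isCompact isOpen_ball).1 hg _
    (closedBall_subset_ball hs) (isCompact_closedBall x s)).mono ball_subset_closedBall

/-- a sequence of functions bigger than one in modulus -/
lemma aux_big {f : ℕ → ℂ → ℂ} {x : ℂ} {r : ℝ} (hr : 0 < r)
    (hd : ∀ n, DifferentiableOn ℂ (f n) (ball x r))
    (hb : ∀ n, ∀ z ∈ ball x r, 1 ≤ ‖f n z‖) :
    ∃ φ : ℕ → ℕ, StrictMono φ ∧
      (AuxConv (fun n => f (φ n)) x (r / 4) ∨ AuxDiv (fun n => f (φ n)) x (r / 4)) := by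
  have h0 : ∀ n, ∀ z ∈ ball x r, f n z ≠ 0 := fun n z hz h => by
    have := hb n z hz; rw [h, norm_zero] at this; linarith
  have hinvd : ∀ n, DifferentiableOn ℂ (fun z => (f n z)⁻¹) (ball x r) :=
    fun n => (hd n).fun_inv (h0 n)
  obtain ⟨φ, hφ, G, hG⟩ := aux_montel (isOpen_ball (x := x) (ε := r)) (fun n z => (f n z)⁻¹) (by
    intro y hy
    obtain ⟨ε, hε, hsub⟩ := Metric.isOpen_iff.1 isOpen_ball y hy
    refine ⟨ε, hε, 1, Eventually.of_forall fun n => ⟨(hinvd n).mono hsub, fun z hz => ?_⟩⟩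
    rw [norm_inv]
    exact inv_le_one_of_one_le₀ (hb n z (hsub hz)))
  have hGd : DifferentiableOn ℂ G (ball x r) :=
    hG.differentiableOn (Eventually.of_forall fun n => hinvd (φ n)) isOpen_ball
  have hU := (tendstoLocallyUniformlyOn_iff_forall_isCompact isOpen_ball).1 hG _
    (closedBall_subset_ball (by linarith : r / 2 < r)) (isCompact_closedBall x (r / 2))
  rw [Metric.tendstoUniformlyOn_iff] at hU
  by_cases hz : ∀ z ∈ ball x r, G z = 0
  · refine ⟨φ, hφ, Or.inr ?_⟩
    intro M
    have hM : 0 < |M| + 1 := by positivity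
    filter_upwards [hU (1 / (|M| + 1)) (by positivity)] with n hn w hw
    have hw2 : w ∈ closedBall x (r / 2) :=
      ball_subset_closedBall (ball_subset_ball (by linarith) hw)
    have hwr : w ∈ ball x r := ball_subset_ball (by linarith) hw
    have := hn w hw2
    rw [hz w hwr, dist_zero_left, norm_inv, one_div] at this
    have := (inv_lt_inv₀ (norm_pos_iff.2 (h0 _ w hwr)) hM).1 this
    have := le_abs_self M
    linarith
  · have hGz : ∀ z ∈ ball x r, G z ≠ 0 := by
      intro z hzb hGz0
      obtain ⟨ε, hε, hsub⟩ := Metric.isOpen_iff.1 isOpen_ball z hzb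
      have hne : ¬ ∀ᶠ w in 𝓝 z, G w = 0 := by
        intro hev
        apply hz
        have := (hGd.analyticOnNhd isOpen_ball).eqOn_zero_of_preconnected_of_eventuallyEq_zero
          (convex_ball x r).isPreconnected hzb hev
        exact fun w hw => this hw
      have := aux_hurwitz hε (Eventually.of_forall fun n => (hinvd (φ n)).mono hsub)
        (hG.mono hsub) hGz0 hne ε hε
      obtain ⟨n, w, hw, hw0⟩ := this.exists
      exact h0 (φ n) w (hsub hw) (inv_eq_zero.1 hw0)
    obtain ⟨y, hy, hymin⟩ := (isCompact_closedBall x (r / 2)).exists_isMinOn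
      (nonempty_closedBall.2 (by linarith)) (f := fun z => ‖G z‖)
      ((hGd.continuousOn.mono (closedBall_subset_ball (by linarith))).norm)
    have hy0 : 0 < ‖G y‖ := norm_pos_iff.2 (hGz y (closedBall_subset_ball (by linarith) hy))
    set m := ‖G y‖
    obtain ⟨ψ, hψ, hc⟩ := aux_montel_ball (f := fun n => f (φ n)) (x := x) (r := r / 2)
      (s := r / 4) (C := 2 / m) (by linarith)
      (Eventually.of_forall fun n => (hd _).mono (ball_subset_ball (by linarith))) (by
        filter_upwards [hU (m / 2) (by positivity)] with n hn z hz
        have h1 := hn z (ball_subset_closedBall hz)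
        have h2 : m ≤ ‖G z‖ := hymin (ball_subset_closedBall hz)
        rw [dist_eq_norm] at h1
        have h3 := norm_sub_norm_le (G z) (f (φ n) z)⁻¹
        rw [norm_inv] at h3
        have h4 : m / 2 ≤ ‖f (φ n) z‖⁻¹ := by linarith
        have h5 := inv_anti₀ (by positivity) h4
        rw [inv_inv, inv_div] at h5
        exact h5)
    exact ⟨fun n => φ (ψ n), hφ.comp hψ, Or.inl hc⟩

lemma aux_normal_of_bound {F : Set (ℂ → ℂ)} {x : ℂ} {r B M : ℝ} (hr : 0 < r)
    (hd : ∀ f ∈ F, DifferentiableOn ℂ f (ball x r))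
    (hb : ∀ f ∈ F, ∀ z ∈ ball x r, ‖deriv f z‖ ≤ B + M * ‖f z‖ ^ 2) : AuxNormalAt F x := by
  refine ⟨r / 16, by positivity, fun f hf => ?_⟩
  have key : ∀ n, (∀ z ∈ ball x (r / 4), ‖f n z‖ ≤ max 1 (Real.exp (r * (B + M)))) ∨
      (∀ z ∈ ball x (r / 4), 1 ≤ ‖f n z‖) := by
    intro n
    by_cases hp : ∃ p ∈ ball x (r / 4), ‖f n p‖ ≤ 1
    · left
      obtain ⟨p, hp, hfp⟩ := hp
      intro w hw
      by_cases hw1 : ‖f n w‖ ≤ 1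
      · exact hw1.trans (le_max_left _ _)
      push Not at hw1
      have hpw : ‖p - w‖ < r / 2 := by
        rw [← dist_eq_norm]
        have := dist_triangle_right p w x
        rw [mem_ball] at hp hw; linarith
      have hsub : closedBall w ‖p - w‖ ⊆ ball x r := by
        intro y hy
        rw [mem_closedBall] at hy
        rw [mem_ball] at *
        have := dist_triangle y w x
        linarith
      have h1 := (aux_pommerenke (C := B + M) isOpen_ball (hd _ (hf n)) hsub hw1 hfp (by
        intro z hz hz1
        have := hb _ (hf n) z (hsub hz)
        rw [hz1] at this; simpa using this)).1
      have hBM : 0 ≤ B + M := by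
        have h2 := Real.log_pos hw1
        by_contra h3
        push Not at h3
        have := mul_nonpos_of_nonneg_of_nonpos (by positivity : 0 ≤ 2 * ‖p - w‖) h3.le
        linarith
      refine le_trans ?_ (le_max_right _ _)
      rw [← Real.log_le_iff_le_exp (by linarith)]
      refine h1.trans ?_
      gcongr
      linarith
    · right
      push Not at hp
      exact fun z hz => (hp z hz).le
  by_cases hfr : ∃ᶠ n in atTop, ∀ z ∈ ball x (r / 4), ‖f n z‖ ≤ max 1 (Real.exp (r * (B + M)))
  · obtain ⟨φ, hφ, hφb⟩ := extraction_of_frequently_atTop hfr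
    obtain ⟨ψ, hψ, hc⟩ := aux_montel_ball (f := fun n => f (φ n)) (x := x) (r := r / 4)
      (s := r / 16) (by linarith)
      (Eventually.of_forall fun n => (hd _ (hf _)).mono (ball_subset_ball (by linarith)))
      (Eventually.of_forall hφb)
    exact ⟨fun n => φ (ψ n), hφ.comp hψ, Or.inl hc⟩
  · rw [not_frequently] at hfr
    obtain ⟨φ, hφ, hφb⟩ := extraction_of_eventually_atTop hfr
    obtain ⟨ψ, hψ, hc⟩ := aux_big (f := fun n => f (φ n)) (x := x) (r := r / 4) (by positivity)
      (fun n => (hd _ (hf _)).mono (ball_subset_ball (by linarith)))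
      (fun n => (key (φ n)).resolve_left (hφb n))
    refine ⟨fun n => φ (ψ n), hφ.comp hψ, ?_⟩
    have : r / 4 / 4 = r / 16 := by ring
    rw [this] at hc
    exact hc


lemma aux_quot_ext {U : Set ℂ} (hU : IsOpen U) {u f : ℂ → ℂ} (hu : DifferentiableOn ℂ u U)
    (hf : DifferentiableOn ℂ f U) (h0 : ∀ z ∈ U, f z = 0 → u z = 0 ∧ deriv f z ≠ 0) :
    ∃ ψ : ℂ → ℂ, DifferentiableOn ℂ ψ U ∧ ∀ z ∈ U, u z = f z * ψ z := by
  classical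
  refine ⟨fun z => if f z = 0 then deriv u z / deriv f z else u z / f z, ?_, ?_⟩
  · intro z hz
    apply DifferentiableAt.differentiableWithinAt
    have hUz := hU.mem_nhds hz
    by_cases hfz : f z = 0
    · obtain ⟨huz, hdf⟩ := h0 z hz hfz
      have h1 : DifferentiableAt ℂ (dslope u z) z :=
        ((Complex.differentiableOn_dslope hUz).2 hu).differentiableAt hUz
      have h2 : DifferentiableAt ℂ (dslope f z) z :=
        ((Complex.differentiableOn_dslope hUz).2 hf).differentiableAt hUz
      have h3 : dslope f z z ≠ 0 := by rwa [dslope_same]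
      have h4 : DifferentiableAt ℂ (fun w => dslope u z w / dslope f z w) z := h1.fun_div h2 h3
      refine h4.congr_of_eventuallyEq ?_
      filter_upwards [h2.continuousAt.eventually_ne h3] with w hw
      by_cases hwz : w = z
      · subst hwz
        simp [hfz, dslope_same]
      · have e1 : f w = (w - z) * dslope f z w := by
          have := sub_smul_dslope f z w
          rw [hfz, sub_zero, smul_eq_mul] at this; exact this.symm
        have e2 : u w = (w - z) * dslope u z w := by
          have := sub_smul_dslope u z w
          rw [huz, sub_zero, smul_eq_mul] at this; exact this.symm
        have hwz' : w - z ≠ 0 := sub_ne_zero.2 hwz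
        have : f w ≠ 0 := by rw [e1]; exact mul_ne_zero hwz' hw
        simp only [this, if_false]
        rw [e1, e2, mul_div_mul_left _ _ hwz']
    · have h1 := hu.differentiableAt hUz
      have h2 := hf.differentiableAt hUz
      refine (h1.fun_div h2 hfz).congr_of_eventuallyEq ?_
      filter_upwards [h2.continuousAt.eventually_ne hfz] with w hw
      simp [hw]
  · intro z hz
    by_cases hfz : f z = 0
    · simp [hfz, (h0 z hz hfz).1]
    · simp [hfz]; field_simp


lemma aux_zerofree {f h : ℂ → ℂ} {z0 : ℂ} {r R ε : ℝ} (hr : 0 < r) (hrR : r < R) (hε : 0 ≤ ε)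
    (hf : DifferentiableOn ℂ f (ball z0 R)) (hh : DifferentiableOn ℂ h (ball z0 R))
    (ha : ∀ z ∈ ball z0 R, f z = 0 → deriv f z = h z ∧ h z ≠ 0)
    (hs : ∀ z ∈ sphere z0 r, ‖h z‖ ≤ ε * ‖f z‖) (hε1 : ε * r * (2 * Real.pi) < 1) :
    ∀ z ∈ closedBall z0 r, f z ≠ 0 := by
  have hO : IsOpen (ball z0 R) := isOpen_ball
  have hsub : closedBall z0 r ⊆ ball z0 R := closedBall_subset_ball hrR
  have hsub' : sphere z0 r ⊆ ball z0 R := sphere_subset_closedBall.trans hsub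
  obtain ⟨ψ, hψd, hψ⟩ := aux_quot_ext hO (hh.sub (hf.deriv hO)) hf (by
    intro z hz hfz
    obtain ⟨h1, h2⟩ := ha z hz hfz
    refine ⟨by simp [h1], by rw [h1]; exact h2⟩)
  obtain ⟨q, -, hq⟩ := hψd.isExactOn_ball.with_val_at z0 0
  set Y : ℂ → ℂ := fun z => f z * exp (q z) with hY
  have hYd : ∀ z ∈ ball z0 R, HasDerivAt Y (h z * exp (q z)) z := by
    intro z hz
    have h1 := (hf.differentiableAt (hO.mem_nhds hz)).hasDerivAt.mul (hq z hz).cexp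
    refine h1.congr_deriv ?_
    have := hψ z hz
    simp only [Pi.sub_apply] at this
    linear_combination (-exp (q z)) * this
  have hYD : DifferentiableOn ℂ Y (ball z0 R) := fun z hz =>
    (hYd z hz).differentiableAt.differentiableWithinAt
  obtain ⟨y, hy, hymax⟩ := (isCompact_sphere z0 r).exists_isMaxOn
    ((NormedSpace.sphere_nonempty).2 hr.le) (f := fun z => ‖Y z‖)
    ((hYD.continuousOn.mono hsub').norm)
  have hy0 : 0 < ‖Y y‖ := by
    rw [norm_pos_iff]
    intro hy0
    have hf0 : f y = 0 := by
      rcases mul_eq_zero.1 hy0 with h1 | h1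
      · exact h1
      · exact absurd h1 (exp_ne_zero _)
    have h1 := hs y hy
    rw [hf0, norm_zero, mul_zero, norm_le_zero_iff] at h1
    exact (ha y (hsub' hy) hf0).2 h1
  have hpar : ∀ z ∈ sphere z0 r, z = circleMap z0 r (arg (z - z0)) := by
    intro z hz
    rw [mem_sphere, dist_eq_norm] at hz
    rw [circleMap, ← hz, Complex.norm_mul_exp_arg_mul_I]; ring
  have hcirc : ∀ z ∈ sphere z0 r, ‖Y z - Y y‖ ≤ ε * r * ‖Y y‖ * (2 * Real.pi) := by
    intro z hz
    have hder : ∀ θ ∈ (univ : Set ℝ), HasDerivWithinAt (fun θ : ℝ => Y (circleMap z0 r θ))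
        ((circleMap 0 r θ * I) * (h (circleMap z0 r θ) * exp (q (circleMap z0 r θ)))) univ θ := by
      intro θ _
      have hm : circleMap z0 r θ ∈ ball z0 R := hsub' (circleMap_mem_sphere z0 hr.le θ)
      have := (hYd _ hm).scomp θ (hasDerivAt_circleMap z0 r θ)
      exact this.hasDerivWithinAt
    have h1 := Convex.norm_image_sub_le_of_norm_hasDerivWithin_le (C := ε * r * ‖Y y‖) hder (by
      intro θ _
      have hm := circleMap_mem_sphere z0 hr.le θ
      have h2 : ‖Y (circleMap z0 r θ)‖ ≤ ‖Y y‖ := hymax hm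
      have h3 := hs _ hm
      simp only [hY, norm_mul] at h2 ⊢
      rw [norm_I, mul_one, norm_circleMap_zero, abs_of_pos hr]
      calc _ ≤ r * (ε * ‖f (circleMap z0 r θ)‖ * ‖exp (q (circleMap z0 r θ))‖) := by gcongr
        _ = ε * r * (‖f (circleMap z0 r θ)‖ * ‖exp (q (circleMap z0 r θ))‖) := by ring
        _ ≤ _ := by gcongr) convex_univ (mem_univ (arg (y - z0))) (mem_univ (arg (z - z0)))
    rw [← hpar z hz, ← hpar y hy] at h1
    refine h1.trans ?_
    gcongr
    rw [Real.norm_eq_abs, abs_le]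
    have := Complex.neg_pi_lt_arg (z - z0)
    have := Complex.arg_le_pi (z - z0)
    have := Complex.neg_pi_lt_arg (y - z0)
    have := Complex.arg_le_pi (y - z0)
    constructor <;> linarith
  intro z hz hfz
  have hdc : DiffContOnCl ℂ (fun z => Y z - Y y) (ball z0 r) := by
    refine DifferentiableOn.diffContOnCl ?_
    rw [closure_ball z0 hr.ne']
    exact (hYD.mono hsub).sub_const _
  have h1 := Complex.norm_le_of_forall_mem_frontier_norm_le (isBounded_ball (x := z0) (r := r)) hdc
    (C := ε * r * ‖Y y‖ * (2 * Real.pi)) (by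
      intro w hw
      rw [frontier_ball z0 hr.ne'] at hw
      exact hcirc w hw) (z := z) (by rwa [closure_ball z0 hr.ne'])
  have h2 : Y z = 0 := by simp [hY, hfz]
  simp only [h2, zero_sub, norm_neg] at h1
  nlinarith

lemma aux_normal_bad {F : Set (ℂ → ℂ)} {h : ℂ → ℂ} {z0 : ℂ} {r R : ℝ} (hr : 0 < r) (hrR : r < R)
    (hf : ∀ f ∈ F, DifferentiableOn ℂ f (ball z0 R)) (hh : DifferentiableOn ℂ h (ball z0 R))
    (ha : ∀ f ∈ F, ∀ z ∈ ball z0 R, f z = 0 → deriv f z = h z ∧ h z ≠ 0)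
    (hN : ∀ x ∈ sphere z0 r, AuxNormalAt F x) : AuxNormalAt F z0 := by
  refine ⟨r, hr, fun f hfF => ?_⟩
  have hsub : closedBall z0 r ⊆ ball z0 R := closedBall_subset_ball hrR
  have hpre : IsPreconnected (sphere z0 r) := isPreconnected_sphere (by
    rw [Complex.rank_real_complex]; norm_num) z0 r
  obtain ⟨φ, hφ, hc⟩ := aux_assemble hpre hN f hfF
  refine ⟨φ, hφ, ?_⟩
  rcases hc with hc | hc
  · left
    obtain ⟨g, hg⟩ := aux_conv_local hc
    rw [tendstoLocallyUniformlyOn_iff_tendstoUniformlyOn_of_compact (isCompact_sphere z0 r)] at hg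
    have hcau := hg.uniformCauchySeqOn
    have hcau2 : UniformCauchySeqOn (fun n => f (φ n)) atTop (closedBall z0 r) := by
      rw [Metric.uniformCauchySeqOn_iff] at hcau ⊢
      intro ε hε
      obtain ⟨N, hN⟩ := hcau (ε / 2) (by positivity)
      refine ⟨N, fun m hm n hn z hz => ?_⟩
      have hdc : DiffContOnCl ℂ (fun z => f (φ m) z - f (φ n) z) (ball z0 r) := by
        refine DifferentiableOn.diffContOnCl ?_
        rw [closure_ball z0 hr.ne']
        exact ((hf _ (hfF _)).mono hsub).sub ((hf _ (hfF _)).mono hsub)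
      have h1 := Complex.norm_le_of_forall_mem_frontier_norm_le
        (isBounded_ball (x := z0) (r := r)) hdc
        (C := ε / 2) (by
          intro w hw
          rw [frontier_ball z0 hr.ne'] at hw
          have := hN m hm n hn w hw
          rw [dist_eq_norm] at this
          exact this.le) (z := z) (by rwa [closure_ball z0 hr.ne'])
      rw [dist_eq_norm]
      exact h1.trans_lt (by linarith)
    have hlim : ∀ z ∈ closedBall z0 r, ∃ y, Tendsto (fun n => f (φ n) z) atTop (𝓝 y) :=
      fun z hz => cauchySeq_tendsto_of_complete (hcau2.cauchySeq hz)
    choose! G hG using hlim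
    exact ⟨G, (hcau2.tendstoUniformlyOn_of_tendsto hG).mono ball_subset_closedBall⟩
  · right
    intro M
    have hcm := fun M' => aux_div_compact (isCompact_sphere z0 r) hc M'
    obtain ⟨A, hA⟩ := (isCompact_sphere z0 r).exists_bound_of_continuousOn
      (hh.continuousOn.mono (sphere_subset_closedBall.trans hsub))
    set ε := 1 / (4 * Real.pi * r) with hε
    have hε0 : 0 < ε := by have := Real.pi_pos; positivity
    filter_upwards [hcm (max M 1), hcm (A / ε)] with n h1 h2
    have hz := aux_zerofree hr hrR hε0.le (hf _ (hfF (φ n))) hh (ha _ (hfF (φ n))) (by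
      intro z hz
      have h3 := hA z hz
      have h4 := h2 z hz
      rw [div_le_iff₀ hε0] at h4
      linarith) (by
      have := Real.pi_pos
      rw [hε]; field_simp; norm_num)
    intro w hw
    have h5 := aux_minmod hr ((hf _ (hfF (φ n))).continuousOn.mono hsub)
      ((hf _ (hfF (φ n))).mono (ball_subset_closedBall.trans hsub))
      (fun z hzb => hz z (ball_subset_closedBall hzb)) (m := max M 1) (by positivity) h1 w
      (ball_subset_closedBall hw)
    exact (le_max_left _ _).trans h5


lemma aux_gron {g : ℂ → ℂ} {w : ℂ} {s C E : ℝ} (hC : 0 < C) (hE : 0 ≤ E)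
    (hd : DifferentiableOn ℂ g (ball w s))
    (hb : ∀ z ∈ ball w s, ‖deriv g z‖ ≤ C * ‖g z‖ + E) :
    ∀ z ∈ ball w s, ‖g z‖ ≤ (‖g w‖ + E / C) * Real.exp (C * s) := by
  intro z hz
  have hs : 0 < s := pos_of_mem_ball hz
  have hzw : ‖z - w‖ < s := by rwa [← dist_eq_norm]
  have hmem : ∀ t ∈ Icc (0 : ℝ) 1, w + (t : ℂ) * (z - w) ∈ ball w s := by
    intro t ht
    rw [mem_ball, dist_eq_norm, add_sub_cancel_left, norm_mul, norm_real, Real.norm_eq_abs,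
      abs_of_nonneg ht.1]
    have : t * ‖z - w‖ ≤ 1 * ‖z - w‖ := by gcongr; exact ht.2
    linarith
  have hder : ∀ t ∈ Icc (0 : ℝ) 1, HasDerivAt (fun t : ℝ => g (w + (t : ℂ) * (z - w)))
      ((z - w) * deriv g (w + (t : ℂ) * (z - w))) t := by
    intro t ht
    have h1 : HasDerivAt g (deriv g (w + (t : ℂ) * (z - w))) (w + (t : ℂ) * (z - w)) :=
      (hd.differentiableAt (isOpen_ball.mem_nhds (hmem t ht))).hasDerivAt
    have h2 : HasDerivAt (fun t : ℝ => w + (t : ℂ) * (z - w)) (z - w) t := by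
      have := ((Complex.ofRealCLM.hasDerivAt (x := t)).mul_const (z - w)).const_add w
      refine this.congr_deriv ?_
      simp
    exact h1.scomp t h2
  have h3 := norm_le_gronwallBound_of_norm_deriv_right_le (f := fun t : ℝ => g (w + (t : ℂ) * (z - w)))
    (f' := fun t : ℝ => (z - w) * deriv g (w + (t : ℂ) * (z - w))) (δ := ‖g w‖) (K := C * s)
    (ε := E * s) (a := 0) (b := 1)
    (fun t ht => (hder t ht).continuousAt.continuousWithinAt)
    (fun t ht => (hder t (Ico_subset_Icc_self ht)).hasDerivWithinAt) (by simp)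
    (by
      intro t ht
      have ht' := Ico_subset_Icc_self ht
      rw [norm_mul]
      have h4 := hb _ (hmem t ht')
      calc _ ≤ s * (C * ‖g (w + (t : ℂ) * (z - w))‖ + E) := by gcongr
        _ = _ := by ring) 1 (by simp)
  rw [gronwallBound_of_K_ne_0 (by positivity)] at h3
  simp only [ofReal_one, one_mul, add_sub_cancel, sub_zero, mul_one] at h3
  refine h3.trans ?_
  have : E * s / (C * s) = E / C := by field_simp
  rw [this]
  have : 0 ≤ E / C := by positivity
  nlinarith

lemma aux_const_of_big {g : ℂ → ℂ} (hg : Differentiable ℂ g) {δ : ℝ}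
    (h0 : deriv g 0 ≠ 0) : ∃ p, δ ≤ ‖g p‖ := by
  by_contra hcon
  push Not at hcon
  obtain ⟨c, hc⟩ := hg.exists_const_forall_eq_of_bounded (by
    rw [isBounded_iff_forall_norm_le]
    refine ⟨δ, ?_⟩
    rintro _ ⟨p, rfl⟩
    exact (hcon p).le)
  have : g = fun _ => c := funext hc
  rw [this] at h0
  simp at h0

lemma aux_const_of_small {g : ℂ → ℂ} (hg : Differentiable ℂ g)
    (h0 : deriv g 0 ≠ 0) : ∃ p, ‖g p‖ ≤ 1 := by
  by_contra hcon
  push Not at hcon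
  have hne : ∀ z, g z ≠ 0 := fun z hz => by
    have := hcon z; rw [hz, norm_zero] at this; linarith
  have hd : Differentiable ℂ (fun z => (g z)⁻¹) := hg.fun_inv hne
  obtain ⟨c, hc⟩ := hd.exists_const_forall_eq_of_bounded (by
    rw [isBounded_iff_forall_norm_le]
    refine ⟨1, ?_⟩
    rintro _ ⟨p, rfl⟩
    simp only [norm_inv]
    exact inv_le_one_of_one_le₀ (hcon p).le)
  have : g = fun _ => c⁻¹ := funext fun z => by rw [← hc z, inv_inv]
  rw [this] at h0
  simp at h0

lemma aux_growth {g : ℂ → ℂ} (hg : Differentiable ℂ g) {C : ℝ} (hC : 0 ≤ C)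
    (h0 : deriv g 0 ≠ 0) (hb : ∀ z, ‖g z‖ ≤ 1 → ‖deriv g z‖ ≤ C) :
    ∀ z, ‖deriv g z‖ ≤ 4 * C * ‖g z‖ + 4 * C := by
  obtain ⟨p, hp⟩ := aux_const_of_small hg h0
  intro w
  have := norm_nonneg (g w)
  by_cases hw : ‖g w‖ ≤ 1
  · have := hb w hw
    nlinarith
  · push Not at hw
    have := (aux_pommerenke (C := C) isOpen_univ hg.differentiableOn (subset_univ _) hw hp
      (fun z _ hz => hb z hz.le)).2
    linarith

lemma aux_iter_bound {g : ℂ → ℂ} (hg : Differentiable ℂ g) {C : ℝ} (hC : 0 < C)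
    (hb : ∀ z, ‖deriv g z‖ ≤ C * ‖g z‖ + C) (k : ℕ) (w : ℂ) :
    ‖iteratedDeriv k g w‖ ≤ k.factorial * ((‖g w‖ + 1) * Real.exp (C * 2)) := by
  have h1 := aux_gron (s := 2) (w := w) hC hC.le hg.differentiableOn (fun z _ => hb z)
  rw [div_self hC.ne'] at h1
  have := norm_iteratedDeriv_le_of_forall_mem_sphere_norm_le k (R := 1) (c := w)
    (C := (‖g w‖ + 1) * Real.exp (C * 2)) one_pos hg.diffContOnCl (fun z hz => h1 z (by
      rw [mem_sphere] at hz; rw [mem_ball]; linarith))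
  simpa using this

lemma aux_lower {g : ℂ → ℂ} (hg : Differentiable ℂ g) {C : ℝ} (hC : 0 < C)
    (hb : ∀ z, ‖deriv g z‖ ≤ C * ‖g z‖ + C) {a : ℂ} (ha : a ≠ 0)
    (hz : ∀ z, g z = 0 → deriv g z = a) :
    ∃ r > 0, ∀ ζ, g ζ = 0 → ∀ z, ‖z - ζ‖ ≤ 2 * r → ‖a‖ / 2 * ‖z - ζ‖ ≤ ‖g z‖ := by
  set L := (2 : ℕ).factorial * ((Real.exp (C * 2) + 1) * Real.exp (C * 2)) with hL
  have hL0 : 0 < L := by positivity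
  have ha0 : 0 < ‖a‖ := norm_pos_iff.2 ha
  have hdd : Differentiable ℂ (deriv g) := by
    intro z
    exact ((hg.differentiableOn (s := univ)).deriv isOpen_univ).differentiableAt univ_mem
  have h2 : ∀ ζ, g ζ = 0 → ∀ z ∈ ball ζ 2, ‖deriv (deriv g) z‖ ≤ L := by
    intro ζ hζ z hzb
    have h1 := aux_gron (s := 2) (w := ζ) hC hC.le hg.differentiableOn (fun z _ => hb z) z hzb
    rw [div_self hC.ne', hζ, norm_zero, zero_add, one_mul] at h1
    have h3 := aux_iter_bound hg hC hb 2 z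
    rw [iteratedDeriv_succ, iteratedDeriv_one] at h3
    refine h3.trans ?_
    rw [hL]; gcongr
  refine ⟨min (1 / 2) (‖a‖ / (4 * L)), by positivity, ?_⟩
  intro ζ hζ z hzζ
  set s := ‖z - ζ‖ with hs
  have hs0 : 0 ≤ s := norm_nonneg _
  have hs1 : s ≤ 1 := by
    have := min_le_left (1 / 2 : ℝ) (‖a‖ / (4 * L)); linarith
  have hs2 : s * L ≤ ‖a‖ / 2 := by
    have := min_le_right (1 / 2 : ℝ) (‖a‖ / (4 * L))
    have h4 : s ≤ 2 * (‖a‖ / (4 * L)) := by linarith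
    calc s * L ≤ 2 * (‖a‖ / (4 * L)) * L := by gcongr
      _ = ‖a‖ / 2 := by field_simp; norm_num
  have hsub : closedBall ζ s ⊆ ball ζ 2 := closedBall_subset_ball (by linarith)
  have hζm : ζ ∈ closedBall ζ s := mem_closedBall_self hs0
  have h3 : ∀ y ∈ closedBall ζ s, ‖deriv g y - a‖ ≤ L * s := by
    intro y hy
    have := Convex.norm_image_sub_le_of_norm_deriv_le (f := deriv g) (C := L)
      (fun x _ => hdd x) (fun x hx => h2 ζ hζ x (hsub hx)) (convex_closedBall ζ s) hζm hy
    rw [hz ζ hζ] at this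
    refine this.trans ?_
    rw [mem_closedBall, dist_eq_norm] at hy
    gcongr
  have h4 : ∀ y ∈ closedBall ζ s, HasDerivWithinAt (fun y => g y - a * y) (deriv g y - a)
      (closedBall ζ s) y := by
    intro y _
    have := (hg y).hasDerivAt.sub ((hasDerivAt_id y).const_mul a)
    refine HasDerivAt.hasDerivWithinAt ?_
    refine this.congr_deriv ?_
    simp
  have h5 := Convex.norm_image_sub_le_of_norm_hasDerivWithin_le h4 h3 (convex_closedBall ζ s) hζm
    (by rw [mem_closedBall, dist_eq_norm] : z ∈ closedBall ζ s)
  rw [hζ] at h5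
  have h6 : g z - a * z - (0 - a * ζ) = g z - a * (z - ζ) := by ring
  rw [h6, ← hs] at h5
  have h7 := norm_sub_norm_le (a * (z - ζ)) (a * (z - ζ) - g z)
  rw [sub_sub_cancel, norm_mul, norm_sub_rev (a * (z - ζ)), ← hs] at h7
  nlinarith


lemma aux_logder {g : ℂ → ℂ} (hg : Differentiable ℂ g) {C r : ℝ} (hC : 0 < C) (hr : 0 < r)
    (hb : ∀ z, ‖deriv g z‖ ≤ C * ‖g z‖ + C) {a : ℂ} (ha : a ≠ 0)
    (hlow : ∀ ζ, g ζ = 0 → ∀ z, ‖z - ζ‖ ≤ 2 * r → ‖a‖ / 2 * ‖z - ζ‖ ≤ ‖g z‖)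
    (hd0 : deriv g 0 ≠ 0) :
    ∃ C' > 0, ∀ w, (∀ ζ, g ζ = 0 → r ≤ ‖w - ζ‖) → ‖deriv g w‖ ≤ C' * ‖g w‖ := by
  have ha0 : 0 < ‖a‖ := norm_pos_iff.2 ha
  set δ := ‖a‖ / 2 * r with hδ
  have hδ0 : 0 < δ := by positivity
  refine ⟨4 * (C + C / δ), by positivity, fun w hw => ?_⟩
  have hCδ : 0 < C / δ := by positivity
  by_cases hwδ : δ ≤ ‖g w‖
  · have h1 := hb w
    have h2 : C ≤ C / δ * ‖g w‖ := by
      calc C = C / δ * δ := by field_simp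
        _ ≤ _ := by gcongr
    have h3 : 0 ≤ C * ‖g w‖ := by positivity
    nlinarith
  · push Not at hwδ
    obtain ⟨p, hp⟩ := aux_const_of_big hg (δ := δ) hd0
    obtain ⟨R, hR, y, -, hyR, hy, hball⟩ := aux_touch (u := fun z => - ‖g z‖) (b := - δ)
      (w := w) (p := p) hg.continuous.norm.neg.continuousOn (by simpa using hwδ)
      (by simpa using hp)
    have hy' : ‖g y‖ = δ := by simpa using hy
    have hball' : ∀ z ∈ ball w R, ‖g z‖ < δ := fun z hz => by simpa using hball z hz
    have hnz : ∀ z ∈ ball w R, g z ≠ 0 := by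
      intro ζ hζ hgζ
      have h1 := hw ζ hgζ
      have h2 : 0 < ‖w - ζ‖ := lt_of_lt_of_le hr h1
      set t : ℝ := r / ‖w - ζ‖ with ht
      have ht0 : 0 ≤ t := by positivity
      have ht1 : t ≤ 1 := by rw [ht, div_le_one h2]; exact h1
      have hm : ζ + t • (w - ζ) ∈ ball w R := by
        have := (convex_ball w R).add_smul_sub_mem hζ (mem_ball_self hR) ⟨ht0, ht1⟩
        exact this
      have hn : ‖ζ + t • (w - ζ) - ζ‖ = r := by
        rw [add_sub_cancel_left, norm_smul, Real.norm_eq_abs, abs_of_nonneg ht0, ht]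
        field_simp
      have h3 := hlow ζ hgζ _ (by rw [hn]; linarith : ‖ζ + t • (w - ζ) - ζ‖ ≤ 2 * r)
      rw [hn] at h3
      have h4 := hball' _ hm
      linarith
    have hy0 : g y ≠ 0 := by
      intro h; rw [h, norm_zero] at hy'; linarith
    have hw0 : g w ≠ 0 := hnz w (mem_ball_self hR)
    have hdf : ∀ z, g z ≠ 0 → HasDerivAt (fun z => (δ : ℂ) * (g z)⁻¹)
        ((δ : ℂ) * (- deriv g z / g z ^ 2)) z := fun z hz =>
      ((hg z).hasDerivAt.fun_inv hz).const_mul _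
    have hnδ : ‖(δ : ℂ)‖ = δ := by rw [norm_real, Real.norm_eq_abs, abs_of_pos hδ0]
    have h5 := (aux_hopf (f := fun z => (δ : ℂ) * (g z)⁻¹) hR
      (fun z hz => (hdf z (hnz z hz)).differentiableAt.differentiableWithinAt) (by
        intro z hz
        have h6 := hball' z hz
        have h7 : 0 < ‖g z‖ := norm_pos_iff.2 (hnz z hz)
        rw [norm_mul, norm_inv, hnδ, ← div_eq_mul_inv, one_lt_div h7]
        exact h6) hyR (hdf y hy0).differentiableAt (by
        rw [norm_mul, norm_inv, hnδ, hy']; field_simp)).2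
    rw [(hdf w hw0).deriv, (hdf y hy0).deriv] at h5
    simp only [norm_mul, norm_div, norm_neg, norm_pow, norm_inv, hnδ, hy'] at h5
    have hgw : 0 < ‖g w‖ := norm_pos_iff.2 hw0
    have h6 := hb y
    rw [hy'] at h6
    have h7 : ‖deriv g w‖ ≤ 4 * (‖deriv g y‖ / δ) * ‖g w‖ := by
      have e1 : δ * (‖deriv g w‖ / ‖g w‖ ^ 2) = ‖deriv g w‖ * (δ / ‖g w‖ ^ 2) := by ring
      have e2 : 4 * (δ * (‖deriv g y‖ / δ ^ 2)) * (δ * ‖g w‖⁻¹)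
          = (4 * (‖deriv g y‖ / δ) * ‖g w‖) * (δ / ‖g w‖ ^ 2) := by
        field_simp
      rw [e1, e2] at h5
      exact le_of_mul_le_mul_right h5 (by positivity)
    refine h7.trans ?_
    have h8 : ‖deriv g y‖ / δ ≤ C + C / δ := by
      rw [div_le_iff₀ hδ0]
      have : (C + C / δ) * δ = C * δ + C := by field_simp
      linarith
    gcongr

lemma aux_ode {g : ℂ → ℂ} (hg : Differentiable ℂ g) {C : ℝ} (hC : 0 < C)
    (hb : ∀ z, ‖deriv g z‖ ≤ C * ‖g z‖ + C) {a : ℂ} (ha : a ≠ 0)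
    (hz : ∀ z, g z = 0 → deriv g z = a) (hd0 : deriv g 0 ≠ 0) (k : ℕ)
    (hk : ∀ z, g z = 0 → iteratedDeriv k g z = 0) :
    ∃ c : ℂ, ∀ z, iteratedDeriv k g z = c * g z := by
  obtain ⟨r, hr, hlow⟩ := aux_lower hg hC hb ha hz
  obtain ⟨C', hC', hld⟩ := aux_logder hg hC hr hb ha hlow hd0
  have ha0 : 0 < ‖a‖ := norm_pos_iff.2 ha
  have hgk : Differentiable ℂ (iteratedDeriv k g) :=
    (hg.contDiff (n := ⊤)).differentiable_iteratedDeriv k (by exact_mod_cast WithTop.coe_lt_top _)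
  obtain ⟨ψ, hψd, hψ⟩ := aux_quot_ext isOpen_univ hgk.differentiableOn hg.differentiableOn
    (fun z _ h0 => ⟨hk z h0, by rw [hz z h0]; exact ha⟩)
  have hψD : Differentiable ℂ ψ := fun z => hψd.differentiableAt univ_mem
  have hψe : ∀ z, iteratedDeriv k g z = g z * ψ z := fun z => hψ z (mem_univ z)
  set δ := ‖a‖ * r with hδ
  have hδ0 : 0 < δ := by positivity
  set K1 := k.factorial * ((1 + 1 / δ) * Real.exp (C * 2)) with hK1
  have hbig : ∀ z, δ ≤ ‖g z‖ → ‖ψ z‖ ≤ K1 := by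
    intro z hzδ
    have h1 := aux_iter_bound hg hC hb k z
    have hgz : 0 < ‖g z‖ := lt_of_lt_of_le hδ0 hzδ
    rw [hψe, norm_mul] at h1
    have h2 : ‖g z‖ + 1 ≤ ‖g z‖ * (1 + 1 / δ) := by
      have : 1 ≤ ‖g z‖ * (1 / δ) := by rw [mul_one_div, one_le_div hδ0]; exact hzδ
      linarith
    refine le_of_mul_le_mul_left (h1.trans ?_) hgz
    calc _ ≤ k.factorial * ((‖g z‖ * (1 + 1 / δ)) * Real.exp (C * 2)) := by gcongr
      _ = _ := by rw [hK1]; ring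
  set K2 := k.factorial * Real.exp (C' * r) / (r / 2) ^ k with hK2
  have hall : ∀ w, ‖ψ w‖ ≤ max K1 K2 := by
    intro w
    by_cases hnear : ∃ ζ, g ζ = 0 ∧ ‖w - ζ‖ ≤ 2 * r
    · obtain ⟨ζ, hζ, hwζ⟩ := hnear
      refine le_trans ?_ (le_max_left _ _)
      have hr2 : 2 * r ≠ 0 := by positivity
      refine Complex.norm_le_of_forall_mem_frontier_norm_le
        (isBounded_ball (x := ζ) (r := 2 * r)) hψD.diffContOnCl (by
          intro y hy
          rw [frontier_ball ζ hr2, mem_sphere, dist_eq_norm] at hy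
          apply hbig
          have := hlow ζ hζ y hy.le
          rw [hy] at this
          rw [hδ]; linarith) (by
          rw [closure_ball ζ hr2, mem_closedBall, dist_eq_norm]; exact hwζ)
    · push Not at hnear
      refine le_trans ?_ (le_max_right _ _)
      have hgw : g w ≠ 0 := fun h => by
        have := hnear w h
        rw [sub_self, norm_zero] at this; linarith
      have h1 := aux_gron (g := g) (w := w) (s := r) hC' le_rfl hg.differentiableOn (by
        intro z hzb
        rw [add_zero]
        apply hld
        intro ζ hζ
        have h2 := hnear ζ hζ
        rw [mem_ball, dist_comm, dist_eq_norm] at hzb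
        have h3 := norm_sub_le_norm_sub_add_norm_sub w z ζ
        linarith)
      rw [zero_div, add_zero] at h1
      have h4 := norm_iteratedDeriv_le_of_forall_mem_sphere_norm_le k (R := r / 2) (c := w)
        (by positivity) hg.diffContOnCl (fun z hzs => h1 z (by
          rw [mem_sphere] at hzs; rw [mem_ball]; linarith))
      rw [hψe, norm_mul] at h4
      refine le_of_mul_le_mul_left (h4.trans (le_of_eq ?_)) (norm_pos_iff.2 hgw)
      rw [hK2]; ring
  obtain ⟨c, hc⟩ := hψD.exists_const_forall_eq_of_bounded (by
    rw [isBounded_iff_forall_norm_le]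
    refine ⟨max K1 K2, ?_⟩
    rintro _ ⟨p, rfl⟩
    exact hall p)
  exact ⟨c, fun z => by rw [hψe, hc, mul_comm]⟩


lemma aux_poly {g : ℂ → ℂ} (hg : Differentiable ℂ g) {k : ℕ}
    (hk : ∀ z, iteratedDeriv k g z = 0) : ∃ P : Polynomial ℂ, ∀ z, g z = P.eval z := by
  have h1 : ∀ n, k ≤ n → iteratedDeriv n g = fun _ => 0 := by
    intro n hn
    induction n, hn using Nat.le_induction with
    | base => exact funext hk
    | succ n _ ih => rw [iteratedDeriv_succ, ih]; simp
  refine ⟨∑ n ∈ Finset.range k,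
    Polynomial.C ((n.factorial : ℂ)⁻¹ * iteratedDeriv n g 0) * Polynomial.X ^ n, fun z => ?_⟩
  rw [← Complex.taylorSeries_eq_of_entire' 0 z hg, tsum_eq_sum (s := Finset.range k)]
  · simp [Polynomial.eval_finsetSum]
  · intro n hn
    rw [Finset.mem_range, not_lt] at hn
    simp [h1 n hn]

lemma aux_case_poly {g : ℂ → ℂ} (hg : Differentiable ℂ g) {k : ℕ} {a : ℂ} (ha : a ≠ 0)
    (hk : ∀ z, iteratedDeriv k g z = 0) (hz : ∀ z, g z = 0 → deriv g z = a)
    (hd0 : ‖a‖ < ‖deriv g 0‖) : False := by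
  classical
  obtain ⟨P, hP⟩ := aux_poly hg hk
  have hgP : g = fun z => P.eval z := funext hP
  have hder : ∀ z, deriv g z = P.derivative.eval z := fun z => by
    rw [hgP]; exact P.deriv
  have hdP : P.natDegree ≠ 0 := by
    intro h
    obtain ⟨b, hb⟩ := Polynomial.natDegree_eq_zero.1 h
    rw [hder, ← hb] at hd0
    simp at hd0
    linarith [norm_nonneg a]
  have hP0 : P ≠ 0 := by rintro rfl; simp at hdP
  have hroot : ∀ x ∈ P.roots, P.derivative.eval x = a := by
    intro x hx
    rw [← hder]; apply hz
    rw [hP]; exact (Polynomial.mem_roots hP0).1 hx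
  have hnodup : P.roots.Nodup := by
    rw [Multiset.nodup_iff_count_le_one]
    intro x
    by_contra hx
    push Not at hx
    have hxr : x ∈ P.roots := Multiset.count_pos.1 (by omega)
    rw [Polynomial.count_roots, Polynomial.one_lt_rootMultiplicity_iff_isRoot hP0] at hx
    have := hroot x hxr
    rw [hx.2] at this
    exact ha this.symm
  have hcard : P.roots.toFinset.card = P.natDegree := by
    rw [Multiset.toFinset_card_of_nodup hnodup, IsAlgClosed.card_roots_eq_natDegree]
  have hQ : P.derivative - Polynomial.C a = 0 := by
    refine Polynomial.eq_zero_of_natDegree_lt_card_of_eval_eq_zero' _ P.roots.toFinset ?_ ?_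
    · intro x hx
      rw [Multiset.mem_toFinset] at hx
      simp [hroot x hx]
    · rw [hcard]
      refine lt_of_le_of_lt (Polynomial.natDegree_sub_C (p := P.derivative)).le ?_
      exact Polynomial.natDegree_derivative_lt hdP
  rw [hder, sub_eq_zero.1 hQ] at hd0
  simp at hd0

lemma aux_exp_ode {e : ℂ → ℂ} {l : ℂ} (he : ∀ z, HasDerivAt e (l * e z) z) (z : ℂ) :
    e z = e 0 * exp (l * z) := by
  have h1 : ∀ z, HasDerivAt (fun z => e z * exp (-(l * z))) 0 z := by
    intro z
    have h2 : HasDerivAt (fun z => -(l * z)) (-l) z := by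
      have := ((hasDerivAt_id z).const_mul l).neg
      refine this.congr_deriv ?_
      simp
    refine ((he z).mul h2.cexp).congr_deriv ?_
    ring
  have h3 := is_const_of_deriv_eq_zero (fun z => (h1 z).differentiableAt) (fun z => (h1 z).deriv) z 0
  simp only [mul_zero, neg_zero, exp_zero, mul_one] at h3
  rw [← h3, mul_assoc, ← exp_add]; simp

lemma aux_repr {g : ℂ → ℂ} (hg : Differentiable ℂ g) {k : ℕ} (hk : 0 < k) {c : ℂ} (hc : c ≠ 0)
    (hode : ∀ z, iteratedDeriv k g z = c * g z) :
    ∃ (T : Finset ℂ) (A : ℂ → ℂ) (ρ : ℝ), 0 < ρ ∧ (∀ l ∈ T, A l ≠ 0 ∧ ‖l‖ = ρ) ∧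
      ∀ z, g z = ∑ l ∈ T, A l * exp (l * z) := by
  classical
  obtain ⟨l0, hl0⟩ := IsAlgClosed.exists_pow_nat_eq c hk
  have hl00 : l0 ≠ 0 := by
    rintro rfl
    rw [zero_pow hk.ne'] at hl0; exact hc hl0.symm
  have hω := Complex.isPrimitiveRoot_exp k hk.ne'
  set ω := exp (2 * Real.pi * I / k) with hωdef
  have hω0 : ω ≠ 0 := exp_ne_zero _
  have hωk : ω ^ k = 1 := hω.pow_eq_one
  set lam : ℕ → ℂ := fun j => l0 * ω ^ j with hlam
  have hlam0 : ∀ j, lam j ≠ 0 := fun j => mul_ne_zero hl00 (pow_ne_zero _ hω0)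
  have hlamk : ∀ j, lam j ^ k = c := fun j => by
    rw [hlam]; simp only; rw [mul_pow, hl0, ← pow_mul, mul_comm j k, pow_mul, hωk, one_pow, mul_one]
  have hinj : ∀ i ∈ Finset.range k, ∀ j ∈ Finset.range k, lam i = lam j → i = j := by
    intro i hi j hj hij
    exact hω.pow_inj (Finset.mem_range.1 hi) (Finset.mem_range.1 hj) (mul_left_cancel₀ hl00 hij)
  set e : ℂ → ℂ → ℂ := fun l z => ∑ m ∈ Finset.range k, (l⁻¹) ^ m * iteratedDeriv m g z with he
  have hgm : ∀ m z, HasDerivAt (iteratedDeriv m g) (iteratedDeriv (m + 1) g z) z := by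
    intro m z
    have : Differentiable ℂ (iteratedDeriv m g) :=
      (hg.contDiff (n := ⊤)).differentiable_iteratedDeriv m (by exact_mod_cast WithTop.coe_lt_top _)
    rw [iteratedDeriv_succ]
    exact (this z).hasDerivAt
  have hed : ∀ l, l ≠ 0 → l ^ k = c → ∀ z, HasDerivAt (e l) (l * e l z) z := by
    intro l hl hlk z
    have h1 : HasDerivAt (e l) (∑ m ∈ Finset.range k, (l⁻¹) ^ m * iteratedDeriv (m + 1) g z) z :=
      HasDerivAt.fun_sum fun m _ => (hgm m z).const_mul _
    refine h1.congr_deriv ?_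
    have h2 : ∀ m, (l⁻¹) ^ m * iteratedDeriv (m + 1) g z
        = l * ((l⁻¹) ^ (m + 1) * iteratedDeriv (m + 1) g z) := fun m => by
      rw [pow_succ]; field_simp
    simp only [h2, he]
    rw [← Finset.mul_sum]
    congr 1
    have h3 := Finset.sum_range_succ (fun m => (l⁻¹) ^ m * iteratedDeriv m g z) k
    rw [Finset.sum_range_succ'] at h3
    have h4 : (l⁻¹) ^ k * iteratedDeriv k g z = (l⁻¹) ^ 0 * iteratedDeriv 0 g z := by
      rw [hode, inv_pow, hlk]; simp; field_simp
    rw [h4] at h3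
    exact add_right_cancel h3
  have hsum : ∀ z, ∑ j ∈ Finset.range k, e (lam j) z = k * g z := by
    intro z
    simp only [he]
    rw [Finset.sum_comm, Finset.sum_eq_single 0]
    · simp
    · intro m hm hm0
      rw [← Finset.sum_mul]
      have h5 : ∑ j ∈ Finset.range k, ((lam j)⁻¹) ^ m = 0 := by
        have h6 : ∀ j, ((lam j)⁻¹) ^ m = (l0⁻¹) ^ m * ((ω⁻¹) ^ m) ^ j := by
          intro j
          simp only [hlam, mul_inv, mul_pow, inv_pow]
          rw [← pow_mul, ← pow_mul, mul_comm]
          ring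
        simp only [h6]
        rw [← Finset.mul_sum]
        have h7 : (ω⁻¹) ^ m ≠ 1 := by
          intro h
          rw [inv_pow, inv_eq_one] at h
          exact hω.pow_ne_one_of_pos_of_lt hm0 (Finset.mem_range.1 hm) h
        have h8 : ((ω⁻¹) ^ m) ^ k = 1 := by
          rw [← pow_mul, mul_comm, pow_mul, inv_pow, hωk]; simp
        have h9 := mul_geom_sum ((ω⁻¹) ^ m) k
        rw [h8, sub_self] at h9
        rw [(mul_eq_zero.1 h9).resolve_left (sub_ne_zero.2 h7), mul_zero]
      rw [h5, zero_mul]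
    · intro h
      exact absurd (Finset.mem_range.2 hk) h
  have hk0 : (k : ℂ) ≠ 0 := by exact_mod_cast hk.ne'
  refine ⟨((Finset.range k).image lam).filter (fun l => e l 0 / k ≠ 0), fun l => e l 0 / k, ‖l0‖,
    norm_pos_iff.2 hl00, ?_, ?_⟩
  · intro l hl
    rw [Finset.mem_filter, Finset.mem_image] at hl
    obtain ⟨⟨j, _, rfl⟩, h2⟩ := hl
    refine ⟨h2, ?_⟩
    simp only [hlam]
    rw [norm_mul, norm_pow, hω.norm'_eq_one hk.ne', one_pow, mul_one]
  · intro z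
    rw [Finset.sum_filter_of_ne, Finset.sum_image hinj]
    · have h1 := hsum z
      have h2 : g z = (∑ j ∈ Finset.range k, e (lam j) z) / k := by rw [h1]; field_simp
      rw [h2, Finset.sum_div]
      refine Finset.sum_congr rfl fun j _ => ?_
      rw [aux_exp_ode (hed (lam j) (hlam0 j) (hlamk j)) z]
      ring
    · intro l _ h h0
      apply h; simp only [h0, zero_mul]


lemma aux_two_max {l1 l2 : ℂ} {ρ : ℝ} (h1 : ‖l1‖ = ρ) (h2 : ‖l2‖ = ρ) (h12 : l1 ≠ l2) :
    l1.re * l2.re + l1.im * l2.im < ρ ^ 2 := by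
  have e1 : l1.re ^ 2 + l1.im ^ 2 = ρ ^ 2 := by
    rw [← h1, Complex.sq_norm, normSq_apply]; ring
  have e2 : l2.re ^ 2 + l2.im ^ 2 = ρ ^ 2 := by
    rw [← h2, Complex.sq_norm, normSq_apply]; ring
  have h3 : 0 < (l1.re - l2.re) ^ 2 + (l1.im - l2.im) ^ 2 := by
    have : 0 < normSq (l1 - l2) := normSq_pos.2 (sub_ne_zero.2 h12)
    rw [normSq_apply] at this
    simp at this
    nlinarith
  nlinarith

lemma aux_exp_pair {A1 A2 l1 l2 : ℂ} (h1 : A1 ≠ 0) (h2 : A2 ≠ 0) (h12 : l1 ≠ l2) :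
    ∃ p, A1 * exp (l1 * p) + A2 * exp (l2 * p) = 0 ∧
      A1 * (l1 * exp (l1 * p)) + A2 * (l2 * exp (l2 * p)) ≠ 0 := by
  have h3 : -A2 / A1 ≠ 0 := div_ne_zero (neg_ne_zero.2 h2) h1
  have h12' : l1 - l2 ≠ 0 := sub_ne_zero.2 h12
  set p := log (-A2 / A1) / (l1 - l2) with hp
  have h4 : exp ((l1 - l2) * p) = -A2 / A1 := by
    rw [hp, mul_div_cancel₀ _ h12', exp_log h3]
  have h5 : exp (l1 * p) = -A2 / A1 * exp (l2 * p) := by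
    rw [← h4, ← exp_add]; congr 1; ring
  have h6 : A1 * exp (l1 * p) + A2 * exp (l2 * p) = 0 := by
    rw [h5]; field_simp; ring
  refine ⟨p, h6, ?_⟩
  have h7 : A1 * (l1 * exp (l1 * p)) + A2 * (l2 * exp (l2 * p))
      = (l1 - l2) * (A1 * exp (l1 * p)) := by linear_combination l2 * h6
  rw [h7]
  exact mul_ne_zero h12' (mul_ne_zero h1 (exp_ne_zero _))

lemma aux_case_generic {g : ℂ → ℂ} (hg : Differentiable ℂ g) {a : ℂ}
    (hz : ∀ z, g z = 0 → deriv g z = a) {T : Finset ℂ} {A : ℂ → ℂ} {ρ : ℝ}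
    (hT : ∀ l ∈ T, A l ≠ 0 ∧ ‖l‖ = ρ) (hrep : ∀ z, g z = ∑ l ∈ T, A l * exp (l * z))
    {l1 l2 u : ℂ} (h1 : l1 ∈ T) (h2 : l2 ∈ T) (h12 : l1 ≠ l2)
    (hu1 : 0 < (l1 * u).re) (hu2 : ((l2 - l1) * u).re = 0) (hu3 : ((l2 - l1) * u).im ≠ 0)
    (hoth : ∀ l ∈ T, l ≠ l1 → l ≠ l2 → ((l - l1) * u).re < 0) : False := by
  classical
  set s := ((l2 - l1) * u).im with hs
  set t : ℕ → ℝ := fun n => 2 * Real.pi * n / |s| with ht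
  have hspos : 0 < |s| := abs_pos.2 hu3
  have httop : Tendsto t atTop atTop := by
    have : t = fun n : ℕ => (2 * Real.pi / |s|) * (n : ℝ) := by
      funext n; simp only [ht]; ring
    rw [this]
    exact tendsto_natCast_atTop_atTop.const_mul_atTop (by have := Real.pi_pos; positivity)
  set B : ℂ → ℂ := fun l => if l = l1 ∨ l = l2 then 1 else 0 with hB
  set E : ℕ → ℂ → ℂ := fun n l => exp ((l - l1) * u * t n) with hE
  have hElim : ∀ l ∈ T, Tendsto (fun n => E n l) atTop (𝓝 (B l)) := by
    intro l hl
    by_cases hl1 : l = l1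
    · subst hl1
      simp [hE, hB]
    by_cases hl2 : l = l2
    · have : ∀ n, E n l = 1 := by
        intro n
        simp only [hE, hl2]
        have h3 : (l2 - l1) * u = s * I := by
          apply Complex.ext
          · rw [hu2]; simp
          · rw [← hs]; simp
        rw [h3, Complex.exp_eq_one_iff]
        rcases abs_cases s with ⟨h4, _⟩ | ⟨h4, _⟩
        · refine ⟨n, ?_⟩
          simp only [ht, h4]
          have : (s : ℂ) ≠ 0 := by exact_mod_cast hu3
          push_cast
          field_simp
        · refine ⟨-n, ?_⟩
          simp only [ht, h4]
          have : (s : ℂ) ≠ 0 := by exact_mod_cast hu3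
          push_cast
          field_simp
      simp only [this]
      simp [hB, hl2]
    · simp only [hB, hl1, hl2, or_self, if_false]
      rw [tendsto_zero_iff_norm_tendsto_zero]
      have h3 : ∀ n, ‖E n l‖ = Real.exp (((l - l1) * u).re * t n) := by
        intro n
        simp only [hE]
        rw [Complex.norm_exp, Complex.re_mul_ofReal]
      simp only [h3]
      refine Real.tendsto_exp_atBot.comp ?_
      exact httop.const_mul_atTop_of_neg (hoth l hl hl1 hl2)
  set hn : ℕ → ℂ → ℂ := fun n z => exp (-(l1 * u * t n)) * g (t n * u + z) with hhn
  have hnrep : ∀ n z, hn n z = ∑ l ∈ T, A l * exp (l * z) * E n l := by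
    intro n z
    simp only [hhn, hrep, hE]
    rw [Finset.mul_sum]
    refine Finset.sum_congr rfl fun l _ => ?_
    have : exp (-(l1 * u * t n)) * (A l * exp (l * (t n * u + z)))
        = A l * (exp (-(l1 * u * t n)) * exp (l * (t n * u + z))) := by ring
    rw [this, ← exp_add, mul_assoc (A l), ← exp_add]
    congr 2; ring
  set G : ℂ → ℂ := fun z => ∑ l ∈ T, A l * exp (l * z) * B l with hG
  have hGeq : ∀ z, G z = A l1 * exp (l1 * z) + A l2 * exp (l2 * z) := by
    intro z
    simp only [hG]
    rw [← Finset.sum_subset (s₁ := {l1, l2})]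
    · rw [Finset.sum_pair h12]; simp [hB]
    · intro x hx
      rw [Finset.mem_insert, Finset.mem_singleton] at hx
      rcases hx with rfl | rfl <;> assumption
    · intro x _ hx
      rw [Finset.mem_insert, Finset.mem_singleton] at hx
      simp [hB, hx]
  obtain ⟨p, hp0, hp1⟩ := aux_exp_pair (hT l1 h1).1 (hT l2 h2).1 h12
  have hGder : HasDerivAt G (A l1 * (l1 * exp (l1 * p)) + A l2 * (l2 * exp (l2 * p))) p := by
    have h3 : ∀ l : ℂ, HasDerivAt (fun z => exp (l * z)) (l * exp (l * p)) p := by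
      intro l
      refine ((hasDerivAt_id p).const_mul l).cexp.congr_deriv ?_
      simp [mul_comm]
    have h4 := ((h3 l1).const_mul (A l1)).add ((h3 l2).const_mul (A l2))
    refine h4.congr_of_eventuallyEq (Eventually.of_forall hGeq)
  have hGp : G p = 0 := by rw [hGeq, hp0]
  have hdG : deriv G p ≠ 0 := by rw [hGder.deriv]; exact hp1
  have hconv : TendstoLocallyUniformlyOn hn G atTop (ball p 1) := by
    apply TendstoUniformlyOn.tendstoLocallyUniformlyOn
    rw [Metric.tendstoUniformlyOn_iff]
    intro ε hε
    have h5 : Tendsto (fun n => ∑ l ∈ T, ‖A l‖ * Real.exp (‖l‖ * (‖p‖ + 1)) * ‖B l - E n l‖) atTop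
        (𝓝 0) := by
      have h6 : ∀ l ∈ T, Tendsto
          (fun n => ‖A l‖ * Real.exp (‖l‖ * (‖p‖ + 1)) * ‖B l - E n l‖) atTop (𝓝 0) := by
        intro l hl
        have h7 : Tendsto (fun n => B l - E n l) atTop (𝓝 0) := by
          have := (hElim l hl).const_sub (B l)
          rwa [sub_self] at this
        have := (h7.norm).const_mul (‖A l‖ * Real.exp (‖l‖ * (‖p‖ + 1)))
        simpa using this
      have := tendsto_finsetSum T h6
      simpa using this
    filter_upwards [h5.eventually (gt_mem_nhds hε)] with n hlt z hzb
    rw [dist_eq_norm, hnrep]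
    simp only [hG]
    rw [← Finset.sum_sub_distrib]
    refine lt_of_le_of_lt ((norm_sum_le _ _).trans (Finset.sum_le_sum fun l _ => ?_)) hlt
    rw [← mul_sub, norm_mul, norm_mul]
    gcongr
    refine (Complex.norm_exp_le_exp_norm _).trans ?_
    rw [norm_mul]
    gcongr
    rw [mem_ball, dist_eq_norm] at hzb
    have := norm_sub_norm_le z p
    linarith
  have hnd : ∀ n z, HasDerivAt (hn n) (exp (-(l1 * u * t n)) * deriv g (t n * u + z)) z := by
    intro n z
    have h3 : HasDerivAt (fun z => g (t n * u + z)) (deriv g (t n * u + z)) z := by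
      have := (hg (t n * u + z)).hasDerivAt.comp_const_add (t n * u) z
      exact this
    exact h3.const_mul _
  have hnD : ∀ n, DifferentiableOn ℂ (hn n) (ball p 1) :=
    fun n z _ => (hnd n z).differentiableAt.differentiableWithinAt
  have hne : ¬ ∀ᶠ z in 𝓝 p, G z = 0 := by
    intro hev
    apply hdG
    have : G =ᶠ[𝓝 p] fun _ => 0 := hev
    rw [this.deriv_eq]; simp
  have hdc := hconv.deriv (Eventually.of_forall hnD) isOpen_ball
  have hGD : DifferentiableOn ℂ G (ball p 1) :=
    hconv.differentiableOn (Eventually.of_forall hnD) isOpen_ball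
  have hpm : p ∈ ball p 1 := mem_ball_self one_pos
  have hcont : ContinuousAt (deriv G) p :=
    ((hGD.deriv isOpen_ball).differentiableAt (isOpen_ball.mem_nhds hpm)).continuousAt
  set m := ‖deriv G p‖ with hm
  have hm0 : 0 < m := norm_pos_iff.2 hdG
  have hev1 : ∀ᶠ z in 𝓝 p, m / 2 < ‖deriv G z‖ := hcont.norm.eventually (lt_mem_nhds (by linarith))
  rw [Metric.eventually_nhds_iff_ball] at hev1
  obtain ⟨ε, hε, hev1⟩ := hev1
  have hU := (tendstoLocallyUniformlyOn_iff_forall_isCompact isOpen_ball).1 hdc _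
    (closedBall_subset_ball (by norm_num : (1 / 2 : ℝ) < 1)) (isCompact_closedBall p (1 / 2))
  rw [Metric.tendstoUniformlyOn_iff] at hU
  have hsmall : Tendsto (fun n => Real.exp (-((l1 * u).re * t n)) * ‖a‖) atTop (𝓝 0) := by
    have h3 : Tendsto (fun n => Real.exp (-((l1 * u).re * t n))) atTop (𝓝 0) := by
      refine Real.tendsto_exp_atBot.comp ?_
      exact tendsto_neg_atTop_atBot.comp (httop.const_mul_atTop hu1)
    simpa using h3.mul_const ‖a‖
  obtain ⟨n, hn1, hn2, hn3⟩ := ((aux_hurwitz one_pos (Eventually.of_forall hnD) hconv hGp hne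
    (min ε (1 / 2)) (by positivity)).and ((hU (m / 4) (by positivity)).and
      (hsmall.eventually (gt_mem_nhds (by positivity : 0 < m / 4))))).exists
  obtain ⟨z, hzb, hz0⟩ := hn1
  have hzε : z ∈ ball p ε := ball_subset_ball (min_le_left _ _) hzb
  have hzh : z ∈ closedBall p (1 / 2) :=
    ball_subset_closedBall (ball_subset_ball (min_le_right _ _) hzb)
  have hgz : g (t n * u + z) = 0 := (mul_eq_zero.1 hz0).resolve_left (exp_ne_zero _)
  have h5 := hz _ hgz
  have h6 : deriv (hn n) z = exp (-(l1 * u * t n)) * a := by rw [(hnd n z).deriv, h5]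
  have h7 := hn2 z hzh
  have h8 := hev1 z hzε
  simp only [Function.comp] at h7
  rw [dist_eq_norm, h6] at h7
  have h9 := norm_sub_norm_le (deriv G z) (exp (-(l1 * u * t n)) * a)
  rw [norm_mul, Complex.norm_exp, neg_re, Complex.re_mul_ofReal] at h9
  linarith


lemma aux_endgame {g : ℂ → ℂ} (hg : Differentiable ℂ g) {a : ℂ} (ha : a ≠ 0) {B M : ℝ}
    (hB : 0 < B + M) (hM : 0 ≤ M) (hb : ∀ z, ‖deriv g z‖ ≤ B + M * ‖g z‖ ^ 2)
    (hz : ∀ z, g z = 0 → deriv g z = a) {k : ℕ} (hk : 0 < k)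
    (hzk : ∀ z, deriv g z = a → iteratedDeriv k g z = 0)
    (hd0 : ‖a‖ < ‖deriv g 0‖) : False := by
  classical
  have hd0' : deriv g 0 ≠ 0 := by
    intro h; rw [h, norm_zero] at hd0; linarith [norm_nonneg a]
  have hgr := aux_growth hg hB.le hd0' (by
    intro z h1
    refine (hb z).trans ?_
    have : ‖g z‖ ^ 2 ≤ 1 := pow_le_one₀ (norm_nonneg _) h1
    nlinarith)
  obtain ⟨c, hc⟩ := aux_ode hg (by positivity : 0 < 4 * (B + M)) hgr ha hz hd0' k
    (fun z h => hzk z (hz z h))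
  by_cases hc0 : c = 0
  · exact aux_case_poly hg (k := k) ha (fun z => by rw [hc, hc0, zero_mul]) hz hd0
  have hzk' : ∀ z, deriv g z = a → g z = 0 := by
    intro z h
    have := hzk z h
    rw [hc] at this
    exact (mul_eq_zero.1 this).resolve_left hc0
  obtain ⟨T, A, ρ, hρ, hT, hrep⟩ := aux_repr hg hk hc0 hc
  by_cases hoff : T.offDiag.Nonempty
  · obtain ⟨⟨l1, l2⟩, hmem, hmax⟩ := T.offDiag.exists_max_image
      (fun q => q.1.re * q.2.re + q.1.im * q.2.im) hoff
    rw [Finset.mem_offDiag] at hmem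
    obtain ⟨h1, h2, h12⟩ := hmem
    simp only at h1 h2 h12 hmax
    have hn1 := (hT l1 h1).2
    have hn2 := (hT l2 h2).2
    have hsq : ∀ l ∈ T, l.re ^ 2 + l.im ^ 2 = ρ ^ 2 := by
      intro l hl
      rw [← (hT l hl).2, Complex.sq_norm, normSq_apply]; ring
    have e1 := hsq l1 h1
    have e2 := hsq l2 h2
    have hlt := aux_two_max hn1 hn2 h12
    have hmax' : ∀ x ∈ T, ∀ y ∈ T, x ≠ y →
        x.re * y.re + x.im * y.im ≤ l1.re * l2.re + l1.im * l2.im := by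
      intro x hx y hy hxy
      exact hmax (x, y) (Finset.mem_offDiag.2 ⟨hx, hy, hxy⟩)
    by_cases hopp : l1 = - l2
    · -- two opposite exponents
      have hTeq : T = {l1, l2} := by
        ext x
        rw [Finset.mem_insert, Finset.mem_singleton]
        constructor
        · intro hx
          by_contra hcon
          push Not at hcon
          have h3 := hmax' x hx l1 h1 hcon.1
          have h4 : x ≠ - l1 := by rw [hopp, neg_neg]; exact hcon.2
          have h5 := aux_two_max (hT x hx).2 (by rw [norm_neg]; exact hn1 : ‖-l1‖ = ρ) h4
          rw [hopp] at h3 h5 e1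
          simp at h3 h5 e1
          nlinarith
        · rintro (rfl | rfl) <;> assumption
      rw [hTeq] at hrep
      have hrep' : ∀ z, g z = A l1 * exp (l1 * z) + A l2 * exp (-(l1 * z)) := by
        intro z
        rw [hrep, Finset.sum_pair h12]
        rw [hopp]; simp
      obtain ⟨p, hp, -⟩ := aux_exp_pair (hT l1 h1).1 (hT l2 h2).1 h12
      have hl1 : l1 ≠ 0 := by
        intro h; rw [h, norm_zero] at hn1; linarith
      set τ := Real.pi * I / l1 with hτ
      have hshift : ∀ z, g (z + τ) = - g z := by
        intro z
        rw [hrep', hrep']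
        have h3 : l1 * (z + τ) = l1 * z + Real.pi * I := by rw [hτ]; field_simp
        rw [h3, exp_add, exp_pi_mul_I, neg_add, exp_add, exp_neg (Real.pi * I), exp_pi_mul_I]
        norm_num
        ring
      have hgp : g p = 0 := by
        rw [hrep, Finset.sum_pair h12]; exact hp
      have hgp' : g (p + τ) = 0 := by rw [hshift, hgp, neg_zero]
      have h4 : deriv g (p + τ) = - deriv g p := by
        have h5 : HasDerivAt (fun z => g (z + τ)) (deriv g (p + τ)) p :=
          (hg (p + τ)).hasDerivAt.comp_add_const p τ
        have h6 : HasDerivAt (fun z => g (z + τ)) (- deriv g p) p := by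
          have := (hg p).hasDerivAt.neg
          refine this.congr_of_eventuallyEq (Eventually.of_forall hshift)
        exact h5.unique h6
      rw [hz _ hgp, hz _ hgp'] at h4
      exact ha (self_eq_neg.1 h4)
    · -- generic case
      have hopp' : l1 ≠ -l2 := hopp
      have hgt := aux_two_max hn1 (by rw [norm_neg]; exact hn2 : ‖-l2‖ = ρ) hopp'
      simp only [neg_re, neg_im] at hgt
      have hrel : ((l2 - l1) * (starRingEnd ℂ) (l1 + l2)).re = 0 := by
        simp [mul_re]; nlinarith
      refine aux_case_generic hg hz hT hrep (u := (starRingEnd ℂ) (l1 + l2)) h1 h2 h12 ?_ hrel ?_ ?_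
      · simp [mul_re]; nlinarith
      · intro him
        have h0 : (l2 - l1) * (starRingEnd ℂ) (l1 + l2) = 0 := Complex.ext hrel him
        rcases mul_eq_zero.1 h0 with h | h
        · exact h12 (sub_eq_zero.1 h).symm
        · rw [map_eq_zero] at h
          exact hopp (eq_neg_of_add_eq_zero_left h)
      · intro l hl hl1 hl2
        have h3 := hmax' l hl l1 h1 hl1
        have h4 := hmax' l hl l2 h2 hl2
        simp [mul_re]; nlinarith
  · rw [Finset.not_nonempty_iff_eq_empty] at hoff
    have hcard : (T : Set ℂ).Subsingleton := by
      intro x hx y hy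
      by_contra hxy
      have : (x, y) ∈ T.offDiag := Finset.mem_offDiag.2 ⟨hx, hy, hxy⟩
      rw [hoff] at this
      simp at this
    rcases hcard.eq_empty_or_singleton with h | ⟨l, h⟩
    · rw [Finset.coe_eq_empty] at h
      rw [h] at hrep
      have : g = fun _ => 0 := by funext z; rw [hrep]; simp
      rw [this] at hd0'
      simp at hd0'
    · have hTl : T = {l} := by rw [← Finset.coe_singleton] at h; exact_mod_cast h
      have hlT : l ∈ T := by rw [hTl]; simp
      obtain ⟨hAl, hnl⟩ := hT l hlT
      have hl0 : l ≠ 0 := by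
        intro h; rw [h, norm_zero] at hnl; linarith
      have hrep' : ∀ z, g z = A l * exp (l * z) := by
        intro z; rw [hrep, hTl]; simp
      have hder : ∀ z, deriv g z = A l * (l * exp (l * z)) := by
        intro z
        have h3 : HasDerivAt (fun z => exp (l * z)) (l * exp (l * z)) z := by
          refine ((hasDerivAt_id z).const_mul l).cexp.congr_deriv ?_
          simp [mul_comm]
        rw [funext hrep']
        exact (h3.const_mul (A l)).deriv
      have hq : a / (A l * l) ≠ 0 := div_ne_zero ha (mul_ne_zero hAl hl0)
      have h5 : deriv g (log (a / (A l * l)) / l) = a := by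
        rw [hder, mul_div_cancel₀ _ hl0, exp_log hq]; field_simp
      have h6 := hzk' _ h5
      rw [hrep'] at h6
      exact mul_ne_zero hAl (exp_ne_zero _) h6


lemma aux_bdd0 {g : ℂ → ℂ} {S B : ℝ} (hS : 2 < S) (hB : 0 ≤ B)
    (hg : DifferentiableOn ℂ g (ball 0 S))
    (hb : ∀ z ∈ ball (0 : ℂ) S, ‖deriv g z‖ ≤ B + 4 * ‖g z‖ ^ 2)
    (h0 : ‖deriv g 0‖ = B + ‖g 0‖ ^ 2) :
    ∀ z, 2 * ‖z‖ + 2 < S → ‖g z‖ ≤ Real.exp (2 * (‖z‖ + 2) * (B + 4)) := by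
  have h0m : (0 : ℂ) ∈ ball (0 : ℂ) S := mem_ball_self (by linarith)
  obtain ⟨p, hp2, hp⟩ : ∃ p : ℂ, ‖p‖ < 2 ∧ ‖g p‖ ≤ 1 := by
    by_contra hcon
    push Not at hcon
    have hne : ∀ z : ℂ, ‖z‖ < 2 → g z ≠ 0 := fun z hz h => by
      have := hcon z hz; rw [h, norm_zero] at this; linarith
    have hdc : DiffContOnCl ℂ (fun z => (g z)⁻¹) (ball 0 (3 / 2)) := by
      refine DifferentiableOn.diffContOnCl ?_
      rw [closure_ball _ (by norm_num)]
      refine DifferentiableOn.fun_inv (hg.mono (closedBall_subset_ball (by linarith))) ?_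
      intro z hz
      rw [mem_closedBall, dist_zero_right] at hz
      exact hne z (by linarith)
    have h1 := norm_deriv_le_of_forall_mem_sphere_norm_le (by norm_num : (0 : ℝ) < 3 / 2) hdc
      (C := 1) (by
        intro z hz
        rw [mem_sphere, dist_zero_right] at hz
        rw [norm_inv]
        exact inv_le_one_of_one_le₀ (hcon z (by linarith)).le)
    have hd : HasDerivAt g (deriv g 0) 0 :=
      (hg.differentiableAt (isOpen_ball.mem_nhds h0m)).hasDerivAt
    have hg0 := hne 0 (by simp)
    rw [(hd.fun_inv hg0).deriv, norm_div, norm_neg, norm_pow, h0] at h1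
    have hg0' : 0 < ‖g 0‖ ^ 2 := by
      have := norm_pos_iff.2 hg0; positivity
    rw [div_le_iff₀ hg0'] at h1
    linarith
  intro w hw
  by_cases hw1 : ‖g w‖ ≤ 1
  · refine hw1.trans (Real.one_le_exp ?_)
    positivity
  push Not at hw1
  have hpw : ‖p - w‖ ≤ ‖w‖ + 2 := by
    have := norm_sub_le p w; linarith
  have hsub : closedBall w ‖p - w‖ ⊆ ball 0 S := by
    intro y hy
    rw [mem_closedBall, dist_eq_norm] at hy
    rw [mem_ball, dist_zero_right]
    have := norm_sub_norm_le y w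
    linarith
  have h1 := (aux_pommerenke (C := B + 4) isOpen_ball hg hsub hw1 hp (by
    intro z hz hz1
    have := hb z (hsub hz)
    rw [hz1] at this; simpa using this)).1
  rw [← Real.log_le_iff_le_exp (by linarith)]
  refine h1.trans ?_
  gcongr

lemma aux_zero_limit {u v : ℕ → ℂ → ℂ} {U V : ℂ → ℂ} {p : ℂ} {s : ℝ} (hs : 0 < s) {ε : ℕ → ℝ}
    (hud : ∀ᶠ n in atTop, DifferentiableOn ℂ (u n) (ball p s))
    (hu : TendstoLocallyUniformlyOn u U atTop (ball p s))
    (hv : TendstoLocallyUniformlyOn v V atTop (ball p s))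
    (hV : ContinuousAt V p) (hU0 : U p = 0) (hne : ¬ ∀ᶠ z in 𝓝 p, U z = 0)
    (hε : Tendsto ε atTop (𝓝 0))
    (huv : ∀ᶠ n in atTop, ∀ z ∈ ball p s, u n z = 0 → ‖v n z‖ ≤ ε n) : V p = 0 := by
  by_contra hVp
  set m := ‖V p‖ with hm
  have hm0 : 0 < m := norm_pos_iff.2 hVp
  have hev1 : ∀ᶠ z in 𝓝 p, m / 2 < ‖V z‖ := hV.norm.eventually (lt_mem_nhds (by linarith))
  rw [Metric.eventually_nhds_iff_ball] at hev1
  obtain ⟨δ, hδ, hev1⟩ := hev1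
  have hsub : closedBall p (s / 2) ⊆ ball p s := closedBall_subset_ball (by linarith)
  have hUn := (tendstoLocallyUniformlyOn_iff_forall_isCompact isOpen_ball).1 hv _
    hsub (isCompact_closedBall p (s / 2))
  rw [Metric.tendstoUniformlyOn_iff] at hUn
  obtain ⟨n, ⟨z, hzb, hz0⟩, hn2, hn3, hn4⟩ := ((aux_hurwitz hs hud hu hU0 hne
    (min δ (s / 2)) (by positivity)).and ((hUn (m / 4) (by positivity)).and
      ((hε.eventually (gt_mem_nhds (by positivity : 0 < m / 4))).and huv))).exists
  have hzδ : z ∈ ball p δ := ball_subset_ball (min_le_left _ _) hzb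
  have hzh : z ∈ closedBall p (s / 2) :=
    ball_subset_closedBall (ball_subset_ball (min_le_right _ _) hzb)
  have h7 := hn2 z hzh
  have h8 := hev1 z hzδ
  have h9 := hn4 z (hsub hzh) hz0
  rw [dist_eq_norm] at h7
  have := norm_sub_norm_le (V z) (v n z)
  linarith

lemma aux_iter_scale (f : ℂ → ℂ) (w ρ : ℂ) (hρ : ρ ≠ 0) (m : ℕ) :
    iteratedDeriv m (fun ζ => f (w + ρ * ζ) / ρ)
      = fun ζ => ρ ^ m / ρ * iteratedDeriv m f (w + ρ * ζ) := by
  induction m with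
  | zero => funext ζ; simp; ring
  | succ m ih =>
    rw [iteratedDeriv_succ, ih]
    funext ζ
    rw [deriv_const_mul_field]
    have h1 : deriv (fun ζ => iteratedDeriv m f (w + ρ * ζ)) ζ
        = ρ * iteratedDeriv (m + 1) f (w + ρ * ζ) := by
      have h2 := deriv_comp_mul_left (𝕜 := ℂ) ρ (fun y => iteratedDeriv m f (w + y)) ζ
      rw [h2, deriv_comp_const_add, smul_eq_mul, iteratedDeriv_succ]
    rw [h1]; ring

lemma aux_iter_conv {u : ℕ → ℂ → ℂ} {G : ℂ → ℂ} {S : ℝ}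
    (hud : ∀ᶠ n in atTop, DifferentiableOn ℂ (u n) (ball 0 S))
    (hu : TendstoLocallyUniformlyOn u G atTop (ball 0 S)) (m : ℕ) :
    (∀ᶠ n in atTop, DifferentiableOn ℂ (iteratedDeriv m (u n)) (ball 0 S)) ∧
    TendstoLocallyUniformlyOn (fun n => iteratedDeriv m (u n)) (iteratedDeriv m G) atTop
      (ball 0 S) := by
  induction m with
  | zero =>
    simp only [iteratedDeriv_zero]
    exact ⟨hud, hu⟩
  | succ m ih =>
    refine ⟨?_, ?_⟩
    · filter_upwards [ih.1] with n hn
      rw [iteratedDeriv_succ]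
      exact hn.deriv isOpen_ball
    · have := ih.2.deriv ih.1 isOpen_ball
      simp only [iteratedDeriv_succ]
      exact this

lemma aux_limit {U : Set ℂ} (hU : IsOpen U) {f : ℕ → ℂ → ℂ} {h : ℂ → ℂ} {k : ℕ} (hk : 2 ≤ k)
    {c B : ℝ} (hf : ∀ n, DifferentiableOn ℂ (f n) U) (hh : DifferentiableOn ℂ h U)
    (ha : ∀ n, ∀ z ∈ U, f n z = 0 → deriv (f n) z = h z)
    (hb : ∀ n, ∀ z ∈ U, deriv (f n) z = h z → ‖iteratedDeriv k (f n) z‖ ≤ c)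
    {w : ℕ → ℂ} {ρ S : ℕ → ℝ} {w' : ℂ} (hρ : ∀ n, 0 < ρ n) (hρ0 : Tendsto ρ atTop (𝓝 0))
    (hS : Tendsto S atTop atTop) (hmem : ∀ n, ∀ ζ ∈ ball (0 : ℂ) (S n), w n + ρ n * ζ ∈ U)
    (hw : Tendsto w atTop (𝓝 w')) (hw' : w' ∈ U) (hh0 : h w' ≠ 0) (hB : ‖h w'‖ < B)
    (hmar : ∀ n, ∀ ζ ∈ ball (0 : ℂ) (S n),
      ‖deriv (f n) (w n + ρ n * ζ)‖ ≤ B + 4 * ‖f n (w n + ρ n * ζ) / ρ n‖ ^ 2)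
    (h0 : ∀ n, ‖deriv (f n) (w n)‖ = B + ‖f n (w n) / ρ n‖ ^ 2) {G : ℂ → ℂ}
    (hG : TendstoLocallyUniformlyOn (fun n ζ => f n (w n + ρ n * ζ) / ρ n) G atTop univ) :
    False := by
  set g : ℕ → ℂ → ℂ := fun n ζ => f n (w n + ρ n * ζ) / ρ n with hg
  have hρC : ∀ n, (ρ n : ℂ) ≠ 0 := fun n => by exact_mod_cast (hρ n).ne'
  have haff : ∀ n, Differentiable ℂ (fun ζ : ℂ => w n + ρ n * ζ) := fun n => by fun_prop
  have hgd : ∀ n, DifferentiableOn ℂ (g n) (ball 0 (S n)) := fun n =>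
    ((hf n).comp (haff n).differentiableOn (hmem n)).div_const _
  have hevS : ∀ s : ℝ, ∀ᶠ n in atTop, ball (0 : ℂ) s ⊆ ball 0 (S n) := fun s => by
    filter_upwards [hS.eventually_ge_atTop s] with n hn using ball_subset_ball hn
  have hgdS : ∀ s : ℝ, ∀ᶠ n in atTop, DifferentiableOn ℂ (g n) (ball 0 s) := fun s => by
    filter_upwards [hevS s] with n hn using (hgd n).mono hn
  have hgd1 : ∀ n ζ, deriv (g n) ζ = deriv (f n) (w n + ρ n * ζ) := by
    intro n ζ
    have := congrFun (aux_iter_scale (f n) (w n) (ρ n) (hρC n) 1) ζ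
    rw [iteratedDeriv_one, iteratedDeriv_one, pow_one, div_self (hρC n), one_mul] at this
    exact this
  have hcS : ∀ s : ℝ, TendstoLocallyUniformlyOn g G atTop (ball 0 s) := fun s =>
    hG.mono (subset_univ _)
  have hGD : Differentiable ℂ G := by
    intro z
    have h1 := (hcS (‖z‖ + 1)).differentiableOn (hgdS _) isOpen_ball
    exact h1.differentiableAt (isOpen_ball.mem_nhds (by simp))
  have hit := fun (s : ℝ) (m : ℕ) => aux_iter_conv (hgdS s) (hcS s) m
  have hpt : ∀ m z, Tendsto (fun n => iteratedDeriv m (g n) z) atTop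
      (𝓝 (iteratedDeriv m G z)) := by
    intro m z
    exact (hit (‖z‖ + 1) m).2.tendsto_at (by simp)
  have hpt0 : ∀ z, Tendsto (fun n => g n z) atTop (𝓝 (G z)) := fun z => by simpa using hpt 0 z
  have hpt1 : ∀ z, Tendsto (fun n => deriv (g n) z) atTop (𝓝 (deriv G z)) := fun z => by
    simpa using hpt 1 z
  have hGb : ∀ z, ‖deriv G z‖ ≤ B + 4 * ‖G z‖ ^ 2 := by
    intro z
    refine le_of_tendsto_of_tendsto (hpt1 z).norm
      ((((hpt0 z).norm.pow 2).const_mul 4).const_add B) ?_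
    filter_upwards [hevS (‖z‖ + 1)] with n hn
    rw [hgd1]
    exact hmar n z (hn (by simp))
  have hG0 : ‖deriv G 0‖ = B + ‖G 0‖ ^ 2 := by
    refine tendsto_nhds_unique (hpt1 0).norm ?_
    have h1 := (((hpt0 0).norm.pow 2).const_add B)
    refine h1.congr fun n => ?_
    rw [hgd1]
    have := h0 n
    simp only [hg, mul_zero, add_zero]
    exact this.symm
  have hB0 : 0 < B := lt_of_le_of_lt (norm_nonneg _) hB
  have hG0' : ‖h w'‖ < ‖deriv G 0‖ := by
    rw [hG0]; have := sq_nonneg ‖G 0‖; linarith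
  have hGan : AnalyticOnNhd ℂ G univ := hGD.differentiableOn.analyticOnNhd isOpen_univ
  have hdGD : Differentiable ℂ (deriv G) := fun z =>
    ((hGD.differentiableOn (s := univ)).deriv isOpen_univ).differentiableAt univ_mem
  -- convergence of h
  have hhc : ContinuousAt h w' := (hh.differentiableAt (hU.mem_nhds hw')).continuousAt
  have hhconv : ∀ s : ℝ, TendstoLocallyUniformlyOn (fun n ζ => h (w n + ρ n * ζ))
      (fun _ => h w') atTop (ball 0 s) := by
    intro s
    apply TendstoUniformlyOn.tendstoLocallyUniformlyOn
    rw [Metric.tendstoUniformlyOn_iff]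
    intro ε hε
    obtain ⟨δ, hδ, hδ'⟩ := Metric.continuousAt_iff.1 hhc ε hε
    have h1 : Tendsto (fun n => ‖w n - w'‖ + ρ n * s) atTop (𝓝 0) := by
      have h2 : Tendsto (fun n => ‖w n - w'‖) atTop (𝓝 0) := by
        rw [← tendsto_iff_norm_sub_tendsto_zero]; exact hw
      simpa using h2.add (hρ0.mul_const s)
    filter_upwards [h1.eventually (gt_mem_nhds hδ)] with n hn ζ hζ
    rw [dist_comm]
    apply hδ'
    rw [dist_eq_norm]
    rw [mem_ball, dist_zero_right] at hζ
    have e1 : w n + ρ n * ζ - w' = (w n - w') + ρ n * ζ := by ring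
    rw [e1]
    refine lt_of_le_of_lt (norm_add_le _ _) (lt_of_le_of_lt ?_ hn)
    rw [norm_mul, norm_real, Real.norm_eq_abs, abs_of_pos (hρ n)]
    have := hρ n
    gcongr
  have hHconv : ∀ s : ℝ, TendstoLocallyUniformlyOn
      (fun n ζ => deriv (g n) ζ - h (w n + ρ n * ζ)) (fun ζ => deriv G ζ - h w') atTop
      (ball 0 s) := by
    intro s
    have h1 := (hit s 1).2
    simp only [iteratedDeriv_one] at h1
    exact h1.fun_sub (hhconv s)
  have hHd : ∀ s : ℝ, ∀ᶠ n in atTop,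
      DifferentiableOn ℂ (fun ζ => deriv (g n) ζ - h (w n + ρ n * ζ)) (ball 0 s) := by
    intro s
    filter_upwards [hevS s, hgdS s] with n hn1 hn2
    exact (hn2.deriv isOpen_ball).sub
      (hh.comp (haff n).differentiableOn (fun ζ hζ => hmem n ζ (hn1 hζ)))
  have hsubp : ∀ p : ℂ, ball p 1 ⊆ ball 0 (‖p‖ + 1) := by
    intro p z hz
    rw [mem_ball, dist_eq_norm] at hz
    rw [mem_ball, dist_zero_right]
    have := norm_sub_norm_le z p
    linarith
  have hz1 : ∀ p, G p = 0 → deriv G p = h w' := by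
    intro p hp
    have hsub := hsubp p
    have hne : ¬ ∀ᶠ z in 𝓝 p, G z = 0 := by
      intro hev
      have h1 := hGan.eqOn_zero_of_preconnected_of_eventuallyEq_zero isPreconnected_univ
        (mem_univ p) hev
      have h2 : G = fun _ => 0 := funext fun z => h1 (mem_univ z)
      rw [h2] at hG0'
      simp at hG0'
      linarith [norm_nonneg (h w')]
    have := aux_zero_limit (ε := fun _ => 0) one_pos ((hgdS _).mono fun n hn => hn.mono hsub)
      ((hcS _).mono hsub) ((hHconv _).mono hsub)
      ((hdGD p).continuousAt.sub continuousAt_const) hp hne tendsto_const_nhds (by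
        filter_upwards [hevS (‖p‖ + 1)] with n hn z hz hz0
        have hzU := hmem n z (hn (hsub hz))
        have hfz : f n (w n + ρ n * z) = 0 := by
          rcases div_eq_zero_iff.1 hz0 with h1 | h1
          · exact h1
          · exact absurd h1 (hρC n)
        rw [hgd1, ha n _ hzU hfz, sub_self, norm_zero])
    exact sub_eq_zero.1 this
  have hz2 : ∀ p, deriv G p = h w' → iteratedDeriv k G p = 0 := by
    intro p hp
    have hsub := hsubp p
    have hne : ¬ ∀ᶠ z in 𝓝 p, deriv G z - h w' = 0 := by
      intro hev
      have han : AnalyticOnNhd ℂ (fun z => deriv G z - h w') univ :=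
        (hdGD.sub_const _).differentiableOn.analyticOnNhd isOpen_univ
      have h1 := han.eqOn_zero_of_preconnected_of_eventuallyEq_zero isPreconnected_univ
        (mem_univ p) hev
      have h2 := h1 (mem_univ (0 : ℂ))
      simp only [Pi.zero_apply] at h2
      rw [sub_eq_zero.1 h2] at hG0'
      exact lt_irrefl _ hG0'
    have hkd : Differentiable ℂ (iteratedDeriv k G) :=
      (hGD.contDiff (n := ⊤)).differentiable_iteratedDeriv k
        (by exact_mod_cast WithTop.coe_lt_top _)
    refine aux_zero_limit (ε := fun n => ρ n ^ (k - 1) * c) one_pos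
      ((hHd _).mono fun n hn => hn.mono hsub)
      ((hHconv _).mono hsub) ((hit _ k).2.mono hsub) (hkd p).continuousAt
      (by rw [hp, sub_self]) hne ?_ ?_
    · have h1 := (hρ0.pow (k - 1)).mul_const c
      rwa [zero_pow (by omega), zero_mul] at h1
    · filter_upwards [hevS (‖p‖ + 1)] with n hn z hz hz0
      have hzU := hmem n z (hn (hsub hz))
      have h1 := hb n _ hzU (by rw [← hgd1]; exact sub_eq_zero.1 hz0)
      simp only [hg]
      rw [aux_iter_scale (f n) (w n) (ρ n) (hρC n) k]
      have e1 : (ρ n : ℂ) ^ k / ρ n = (ρ n : ℂ) ^ (k - 1) := by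
        obtain ⟨j, rfl⟩ : ∃ j, k = j + 1 := ⟨k - 1, by omega⟩
        rw [pow_succ, Nat.add_sub_cancel, mul_div_assoc, div_self (hρC n), mul_one]
      simp only [e1]
      rw [norm_mul, norm_pow, norm_real, Real.norm_eq_abs, abs_of_pos (hρ n)]
      have := hρ n
      gcongr
  exact aux_endgame hGD hh0 (by linarith) (by norm_num) hGb hz1 (by omega : 0 < k) hz2 hG0'


lemma aux_rescale {f : ℂ → ℂ} {z0 v : ℂ} {r R B N : ℝ} (hr : 0 < r) (hrR : r < R)
    (hf : DifferentiableOn ℂ f (ball z0 R))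
    (hz : ∀ z ∈ closedBall z0 r, f z = 0 → ‖deriv f z‖ < B) (hN : 0 < N)
    (hv : v ∈ ball z0 (r / 2)) (hQ : B + N * ‖f v‖ ^ 2 < ‖deriv f v‖) :
    ∃ w ∈ closedBall z0 r, ∃ ρ > 0, ρ ≤ 2 / √N ∧
      (∀ ζ ∈ ball (0 : ℂ) (√N * r / 4), w + (ρ : ℂ) * ζ ∈ ball z0 r ∧
        ‖deriv f (w + (ρ : ℂ) * ζ)‖ ≤ B + 4 * ‖f (w + (ρ : ℂ) * ζ) / (ρ : ℂ)‖ ^ 2) ∧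
      ‖deriv f w‖ = B + ‖f w / (ρ : ℂ)‖ ^ 2 := by
  set Q : ℂ → ℝ := fun z => max (‖deriv f z‖ - B) 0 / ‖f z‖ ^ 2 with hQd
  have hsub : closedBall z0 r ⊆ ball z0 R := closedBall_subset_ball hrR
  have hQc : ContinuousOn Q (closedBall z0 r) := by
    intro z hzm
    have hnh : ball z0 R ∈ 𝓝 z := isOpen_ball.mem_nhds (hsub hzm)
    have hfc : ContinuousAt f z := (hf.differentiableAt hnh).continuousAt
    have hdc : ContinuousAt (deriv f) z :=
      ((hf.deriv isOpen_ball).differentiableAt hnh).continuousAt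
    apply ContinuousAt.continuousWithinAt
    by_cases h0 : f z = 0
    · have hlt := hz z hzm h0
      have hev : ∀ᶠ y in 𝓝 z, ‖deriv f y‖ < B := hdc.norm.eventually_lt continuousAt_const hlt
      have : Q =ᶠ[𝓝 z] fun _ => (0 : ℝ) := by
        filter_upwards [hev] with y hy
        simp only [hQd]
        rw [max_eq_right (by linarith), zero_div]
      exact continuousAt_const.congr this.symm
    · exact ((hdc.norm.sub continuousAt_const).max continuousAt_const).div
        (hfc.norm.pow 2) (by positivity)
  have hQ0 : ∀ z, 0 ≤ Q z := fun z => by positivity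
  have hvc : v ∈ closedBall z0 r := by
    rw [mem_ball] at hv; rw [mem_closedBall]; linarith
  have hfv : f v ≠ 0 := by
    intro h0
    have := hz v hvc h0
    rw [h0] at hQ
    simp at hQ
    linarith
  have hfv' : 0 < ‖f v‖ := norm_pos_iff.2 hfv
  have hQv : N < Q v := by
    simp only [hQd]
    rw [lt_div_iff₀ (by positivity)]
    exact lt_of_lt_of_le (by linarith) (le_max_left _ _)
  obtain ⟨w, hw, hmax⟩ := (isCompact_closedBall z0 r).exists_isMaxOn
    ⟨v, hvc⟩ (f := fun z => Q z * (r - ‖z - z0‖) ^ 2) (hQc.mul (by fun_prop))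
  have hmax' : ∀ z ∈ closedBall z0 r, Q z * (r - ‖z - z0‖) ^ 2 ≤ Q w * (r - ‖w - z0‖) ^ 2 :=
    fun z hz => hmax hz
  set d := r - ‖w - z0‖ with hd
  have hd0 : 0 ≤ d := by rw [mem_closedBall, dist_eq_norm] at hw; linarith
  have hdr : d ≤ r := by have := norm_nonneg (w - z0); linarith
  have hbig : N * (r / 2) ^ 2 < Q w * d ^ 2 := by
    refine lt_of_lt_of_le ?_ (hmax' v hvc)
    rw [mem_ball, dist_eq_norm] at hv
    have h1 : (r / 2) ^ 2 ≤ (r - ‖v - z0‖) ^ 2 := by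
      apply pow_le_pow_left₀ (by positivity); linarith
    have h2 : 0 < (r / 2) ^ 2 := by positivity
    nlinarith
  have hpos : 0 < Q w * d ^ 2 := lt_trans (by positivity) hbig
  have hdp : 0 < d := by
    rcases hd0.eq_or_lt with h | h
    · rw [← h] at hpos; simp at hpos
    · exact h
  have hQw : 0 < Q w := by
    rcases (hQ0 w).eq_or_lt with h | h
    · rw [← h] at hpos; simp at hpos
    · exact h
  set s := √(Q w) with hs
  have hsp : 0 < s := Real.sqrt_pos.2 hQw
  have hs2 : s ^ 2 = Q w := Real.sq_sqrt hQw.le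
  have hNp : 0 < √N := Real.sqrt_pos.2 hN
  have hN2 : √N ^ 2 = N := Real.sq_sqrt hN.le
  have hkey : √N * (r / 2) ≤ s * d := by
    refine (sq_le_sq₀ (by positivity) (by positivity)).1 ?_
    rw [mul_pow, mul_pow, hs2, hN2]; exact hbig.le
  have hρn : ‖((s⁻¹ : ℝ) : ℂ)‖ = s⁻¹ := by
    rw [Complex.norm_real, Real.norm_of_nonneg (by positivity)]
  refine ⟨w, hw, s⁻¹, by positivity, ?_, ?_, ?_⟩
  · rw [inv_le_comm₀ hsp (by positivity), inv_div]
    have : s * d ≤ s * r := by gcongr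
    nlinarith
  · intro ζ hζ
    rw [mem_ball_zero_iff] at hζ
    set z := w + ((s⁻¹ : ℝ) : ℂ) * ζ with hzd
    have hzw : ‖z - w‖ < d / 2 := by
      have : z - w = ((s⁻¹ : ℝ) : ℂ) * ζ := by rw [hzd]; ring
      rw [this, norm_mul, hρn]
      have h1 : s⁻¹ * ‖ζ‖ < s⁻¹ * (√N * r / 4) := by gcongr
      have h2 : s⁻¹ * (√N * r / 4) ≤ d / 2 := by
        rw [inv_mul_le_iff₀ hsp]; linarith
      linarith
    have hzz : ‖z - z0‖ ≤ ‖z - w‖ + ‖w - z0‖ := norm_sub_le_norm_sub_add_norm_sub _ _ _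
    have hzb : z ∈ ball z0 r := by rw [mem_ball, dist_eq_norm]; linarith
    refine ⟨hzb, ?_⟩
    have hzc := ball_subset_closedBall hzb
    have hm := hmax' z hzc
    have hQz : Q z ≤ 4 * Q w := by
      have h1 : (d / 2) ^ 2 ≤ (r - ‖z - z0‖) ^ 2 := by
        apply pow_le_pow_left₀ (by positivity); linarith
      have h2 : Q z * (d / 2) ^ 2 ≤ Q w * d ^ 2 :=
        (mul_le_mul_of_nonneg_left h1 (hQ0 z)).trans hm
      have h3 : 0 < d ^ 2 := by positivity
      have h4 : Q z * d ^ 2 ≤ (4 * Q w) * d ^ 2 := by nlinarith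
      exact le_of_mul_le_mul_right h4 h3
    rw [norm_div, hρn]
    by_cases h0 : f z = 0
    · have := hz z hzc h0
      rw [h0]; simp; exact this.le
    · have hfz : 0 < ‖f z‖ := norm_pos_iff.2 h0
      simp only [hQd] at hQz
      rw [div_le_iff₀ (by positivity)] at hQz
      have h5 := (le_max_left _ _).trans hQz
      have h6 : (‖f z‖ / s⁻¹) ^ 2 = Q w * ‖f z‖ ^ 2 := by
        rw [div_inv_eq_mul, mul_pow, hs2]; ring
      rw [h6]
      simp only [hQd]
      linarith
  · rw [norm_div, hρn]
    have h6 : (‖f w‖ / s⁻¹) ^ 2 = Q w * ‖f w‖ ^ 2 := by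
      rw [div_inv_eq_mul, mul_pow, hs2]; ring
    rw [h6]
    have hfw : ‖f w‖ ^ 2 ≠ 0 := by
      intro h0
      simp only [hQd] at hQw
      rw [h0] at hQw; simp at hQw
    have hm : max (‖deriv f w‖ - B) 0 = ‖deriv f w‖ - B := by
      apply max_eq_left
      by_contra hlt
      simp only [hQd] at hQw
      rw [max_eq_right (not_le.1 hlt).le] at hQw; simp at hQw
    have h7 : Q w * ‖f w‖ ^ 2 = max (‖deriv f w‖ - B) 0 := div_mul_cancel₀ _ hfw
    rw [h7, hm]; ring

lemma aux_normal_good {F : Set (ℂ → ℂ)} {h : ℂ → ℂ} {z0 : ℂ} {r R c : ℝ} {k : ℕ} (hk : 2 ≤ k)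
    (hr : 0 < r) (hrR : r < R)
    (hf : ∀ f ∈ F, DifferentiableOn ℂ f (ball z0 R)) (hh : DifferentiableOn ℂ h (ball z0 R))
    (hne : ∀ z ∈ closedBall z0 r, h z ≠ 0)
    (ha : ∀ f ∈ F, ∀ z ∈ ball z0 R, f z = 0 → deriv f z = h z)
    (hb : ∀ f ∈ F, ∀ z ∈ ball z0 R, deriv f z = h z → ‖iteratedDeriv k f z‖ ≤ c) :
    AuxNormalAt F z0 := by
  have hsub : closedBall z0 r ⊆ ball z0 R := closedBall_subset_ball hrR
  obtain ⟨A, hA⟩ := (isCompact_closedBall z0 r).exists_bound_of_continuousOn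
    (hh.continuousOn.mono hsub)
  have hA0 : 0 ≤ A := (norm_nonneg _).trans (hA z0 (mem_closedBall_self hr.le))
  set B := A + 1 with hB
  by_cases hM : ∃ M : ℝ, ∀ f ∈ F, ∀ z ∈ ball z0 (r / 2), ‖deriv f z‖ ≤ B + M * ‖f z‖ ^ 2
  · obtain ⟨M, hM⟩ := hM
    exact aux_normal_of_bound (by positivity : 0 < r / 2)
      (fun f hfF => (hf f hfF).mono (ball_subset_ball (by linarith))) hM
  push Not at hM
  exfalso
  choose f hfF v hv hQ using fun n : ℕ => hM (n + 1)
  have hres := fun n : ℕ => aux_rescale hr hrR (hf (f n) (hfF n))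
    (fun z hz h0 => by
      rw [ha (f n) (hfF n) z (hsub hz) h0]; have := hA z hz; linarith)
    (by positivity : (0 : ℝ) < (n : ℝ) + 1) (hv n) (hQ n)
  choose w hw ρ hρ hρ2 hmar h0 using hres
  obtain ⟨w', hw', φ, hφ, hlim⟩ := (isCompact_closedBall z0 r).tendsto_subseq hw
  have hsq : Tendsto (fun n : ℕ => √((n : ℝ) + 1)) atTop atTop :=
    Real.tendsto_sqrt_atTop.comp (tendsto_natCast_atTop_atTop.atTop_add tendsto_const_nhds)
  have hS : Tendsto (fun n : ℕ => √((n : ℝ) + 1) * r / 4) atTop atTop :=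
    (hsq.atTop_mul_const hr).atTop_div_const (by norm_num)
  have hρ0 : Tendsto ρ atTop (𝓝 0) :=
    squeeze_zero (fun n => (hρ n).le) hρ2 (tendsto_const_nhds.div_atTop hsq)
  have hbR : ball z0 r ⊆ ball z0 R := ball_subset_ball hrR.le
  set S : ℕ → ℝ := fun n => √((n : ℝ) + 1) * r / 4 with hSd
  set g : ℕ → ℂ → ℂ := fun n ζ => f n (w n + ρ n * ζ) / ρ n with hg
  have hρC : ∀ n, (ρ n : ℂ) ≠ 0 := fun n => by exact_mod_cast (hρ n).ne'
  have hgd1 : ∀ n ζ, deriv (g n) ζ = deriv (f n) (w n + ρ n * ζ) := by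
    intro n ζ
    have := congrFun (aux_iter_scale (f n) (w n) (ρ n) (hρC n) 1) ζ
    rw [iteratedDeriv_one, iteratedDeriv_one, pow_one, div_self (hρC n), one_mul] at this
    exact this
  have haff : ∀ n, Differentiable ℂ (fun ζ : ℂ => w n + ρ n * ζ) := fun n => by fun_prop
  have hgd : ∀ n, DifferentiableOn ℂ (g n) (ball 0 (S n)) := fun n =>
    ((hf (f n) (hfF n)).comp (haff n).differentiableOn
      (fun ζ hζ => hbR (hmar n ζ hζ).1)).div_const _
  have hbd : ∀ n, 2 < S n → ∀ z, 2 * ‖z‖ + 2 < S n →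
      ‖g n z‖ ≤ Real.exp (2 * (‖z‖ + 2) * (B + 4)) := by
    intro n hn
    refine aux_bdd0 hn (by linarith) (hgd n) ?_ ?_
    · intro z hz
      rw [hgd1]; exact (hmar n z hz).2
    · rw [hgd1]; simp only [hg, mul_zero, add_zero]; exact h0 n
  obtain ⟨ψ, hψ, G, hG⟩ := aux_montel (U := univ) isOpen_univ (fun n => g (φ n)) (by
    intro x _
    refine ⟨1, one_pos, Real.exp (2 * (‖x‖ + 1 + 2) * (B + 4)), ?_⟩
    filter_upwards [(hS.comp hφ.tendsto_atTop).eventually_gt_atTop (2 * (‖x‖ + 1) + 2)] with n hn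
    have hn' : 2 * (‖x‖ + 1) + 2 < S (φ n) := hn
    have hx0 := norm_nonneg x
    have hxz : ∀ z ∈ ball x 1, ‖z‖ ≤ ‖x‖ + 1 := by
      intro z hz
      rw [mem_ball, dist_eq_norm] at hz
      have := norm_le_norm_add_norm_sub' z x
      linarith
    refine ⟨(hgd _).mono ?_, ?_⟩
    · intro z hz
      rw [mem_ball_zero_iff]
      have := hxz z hz
      linarith
    · intro z hz
      have := hxz z hz
      refine (hbd _ (by linarith) z (by linarith)).trans ?_
      apply Real.exp_le_exp.2
      gcongr)
  have hχ : StrictMono (φ ∘ ψ) := hφ.comp hψ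
  have hχt := hχ.tendsto_atTop
  exact aux_limit (U := ball z0 R) isOpen_ball (f := fun n => f (φ (ψ n))) hk
    (fun n => hf _ (hfF _)) hh (fun n => ha _ (hfF _)) (fun n => hb _ (hfF _))
    (w := fun n => w (φ (ψ n))) (ρ := fun n => ρ (φ (ψ n))) (S := fun n => S (φ (ψ n))) (w' := w')
    (B := B)
    (fun n => hρ _) (hρ0.comp hχt) (hS.comp hχt) (fun n ζ hζ => hbR (hmar _ ζ hζ).1)
    (hlim.comp hψ.tendsto_atTop) (hsub hw') (hne _ hw') (by have := hA _ hw'; linarith)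
    (fun n ζ hζ => (hmar _ ζ hζ).2) (fun n => h0 _) hG

lemma aux_final (D : Set ℂ) (hD : IsOpen D) (hDconn : IsConnected D)
    (F : Set (ℂ → ℂ)) (hol : ∀ f ∈ F, DifferentiableOn ℂ f D)
    (k : ℕ) (hk : 2 ≤ k)
    (h : ℂ → ℂ) (hh : DifferentiableOn ℂ h D) (hh0 : ¬ ∀ z ∈ D, h z = 0)
    (hnc : ∀ f ∈ F, ∀ z ∈ D, ¬ (h z = 0 ∧ f z = 0))
    (c : ℝ)
    (ha : ∀ f ∈ F, ∀ z ∈ D, f z = 0 → deriv f z = h z)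
    (hb : ∀ f ∈ F, ∀ z ∈ D, deriv f z = h z → ‖iteratedDeriv k f z‖ ≤ c) :
    ∀ f : ℕ → ℂ → ℂ, (∀ n, f n ∈ F) → ∃ φ : ℕ → ℕ, StrictMono φ ∧
    ((∃ g : ℂ → ℂ, TendstoLocallyUniformlyOn (fun n => f (φ n)) g Filter.atTop D) ∨
      (∀ K : Set ℂ, K ⊆ D → IsCompact K → ∀ M : ℝ,
        ∀ᶠ n in Filter.atTop, ∀ z ∈ K, M ≤ ‖f (φ n) z‖)) := by
  have good : ∀ x ∈ D, h x ≠ 0 → AuxNormalAt F x := by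
    intro x hx hhx
    have h1 : ∀ᶠ y in 𝓝 x, h y ≠ 0 :=
      ((hh.differentiableAt (hD.mem_nhds hx)).continuousAt).eventually_ne hhx
    obtain ⟨R, hR, hRs⟩ := Metric.mem_nhds_iff.1 (inter_mem h1 (hD.mem_nhds hx))
    have hRD : ball x R ⊆ D := fun y hy => (hRs hy).2
    exact aux_normal_good hk (half_pos hR) (half_lt_self hR)
      (fun f hf => (hol f hf).mono hRD) (hh.mono hRD)
      (fun z hz => (hRs (closedBall_subset_ball (half_lt_self hR) hz)).1)
      (fun f hf z hz => ha f hf z (hRD hz)) (fun f hf z hz => hb f hf z (hRD hz))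
  have hall : ∀ x ∈ D, AuxNormalAt F x := by
    intro x hx
    by_cases hhx : h x = 0
    · have han : AnalyticOnNhd ℂ h D := hh.analyticOnNhd hD
      have h1 : ∀ᶠ y in 𝓝[≠] x, h y ≠ 0 := by
        by_contra hcon
        have hfr : ∃ᶠ y in 𝓝[≠] x, h y = 0 := by
          intro hev; exact hcon hev
        exact hh0 (han.eqOn_zero_of_preconnected_of_frequently_eq_zero
          hDconn.isPreconnected hx hfr)
      rw [eventually_nhdsWithin_iff] at h1
      obtain ⟨R, hR, hRs⟩ := Metric.mem_nhds_iff.1 (inter_mem h1 (hD.mem_nhds hx))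
      have hRD : ball x R ⊆ D := fun y hy => (hRs hy).2
      refine aux_normal_bad (half_pos hR) (half_lt_self hR)
        (fun f hf => (hol f hf).mono hRD) (hh.mono hRD)
        (fun f hf z hz h0 => ⟨ha f hf z (hRD hz) h0, fun hz0 => hnc f hf z (hRD hz) ⟨hz0, h0⟩⟩) ?_
      intro y hy
      have hyb : y ∈ ball x R := by
        rw [mem_sphere] at hy; rw [mem_ball]; linarith
      have hyx : y ≠ x := by
        rintro rfl
        rw [mem_sphere, dist_self] at hy; linarith
      exact good y (hRD hyb) ((hRs hyb).1 hyx)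
    · exact good x hx hhx
  intro f hf
  obtain ⟨φ, hφ, hc⟩ := aux_assemble hDconn.isPreconnected hall f hf
  refine ⟨φ, hφ, ?_⟩
  rcases hc with hc | hc
  · exact Or.inl (aux_conv_local hc)
  · exact Or.inr fun K hK hKc M => aux_div_compact hKc (fun x hx => hc x (hK hx)) M

end AuxSection

/-- Theorem 1: if `k ≥ 2`, `h ≢ 0` is holomorphic on `D` with no common zeros with any
`f ∈ F`, and every `f ∈ F` satisfies (a) `f(z)=0 ⟹ f'(z)=h(z)` and
(b) `f'(z)=h(z) ⟹ |f^{(k)}(z)| ≤ c`, then `F` is normal on `D`. -/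
theorem stmt_14 (D : Set ℂ) (hD : IsOpen D) (hDconn : IsConnected D)
    (F : Set (ℂ → ℂ)) (hol : ∀ f ∈ F, DifferentiableOn ℂ f D)
    (k : ℕ) (hk : 2 ≤ k)
    (h : ℂ → ℂ) (hh : DifferentiableOn ℂ h D) (hh0 : ¬ ∀ z ∈ D, h z = 0)
    (hnc : ∀ f ∈ F, ∀ z ∈ D, ¬ (h z = 0 ∧ f z = 0))
    (c : ℝ)
    (ha : ∀ f ∈ F, ∀ z ∈ D, f z = 0 → deriv f z = h z)
    (hb : ∀ f ∈ F, ∀ z ∈ D, deriv f z = h z → ‖iteratedDeriv k f z‖ ≤ c) :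
    SphericallyNormalOn F D := by
  exact aux_final D hD hDconn F hol k hk h hh hh0 hnc c ha hb
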